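/- arXiv:1104.3915 — 10 statements merged into one kernel-verified Lean document; each statement's English description precedes it below -/
import Mathlib

section
/- A bipartite graph G = (A,B,E) is chordal bipartite if and only if G has a perfect edge without vertex elimination ordering, i.e., an ordering (e_1, …, e_m) of all edges of G such that for every i ∈ {1, …, m}, the edge e_i is bisimplicial in the graph G_{i-1} obtained from G by deleting the edges e_1, …, e_{i-1} (but not their endpoints). -/
variable {V : Type*}

/-- `G` contains an induced cycle on `n` vertices. -/
def hasInducedCycle (G : SimpleGraph V) (n : ℕ) : Prop :=
  ∃ f : Fin n → V, Function.Injective f ∧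
    ∀ i j : Fin n, G.Adj (f i) (f j) ↔ ((i.val + 1) % n = j.val ∨ (j.val + 1) % n = i.val)

/-- `{A, B}` is a bipartition of `G` into two color classes. -/
def IsBipartition (G : SimpleGraph V) (A B : Set V) : Prop :=
  (∀ v, v ∈ A ∨ v ∈ B) ∧ (∀ v, ¬ (v ∈ A ∧ v ∈ B)) ∧
    ∀ ⦃x y⦄, G.Adj x y → (x ∈ A ∧ y ∈ B) ∨ (x ∈ B ∧ y ∈ A)

/-- A graph is chordal bipartite if it has no induced cycle of length more than four. -/
def ChordalBipartite (G : SimpleGraph V) : Prop :=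
  ∀ n, 5 ≤ n → ¬ hasInducedCycle G n

/-- An edge `(x, y)` is bisimplicial if `N(x) ∪ N(y)` induces a complete bipartite subgraph:
every vertex of `N(x)` is adjacent to every (distinct) vertex of `N(y)`. -/
def Bisimplicial (G : SimpleGraph V) (x y : V) : Prop :=
  G.Adj x y ∧ ∀ a ∈ G.neighborSet x, ∀ b ∈ G.neighborSet y, a ≠ b → G.Adj a b

/-- `l` is a perfect edge without vertex elimination ordering of `G`: a duplicate-free
enumeration of all edges of `G` such that each edge is bisimplicial in the graph obtained
by deleting the earlier edges (but not their endpoints). -/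
def PerfectEdgeElimOrdering (G : SimpleGraph V) (l : List (V × V)) : Prop :=
  (l.map fun p => s(p.1, p.2)).Nodup ∧
  (∀ e, e ∈ G.edgeSet ↔ e ∈ l.map fun p => s(p.1, p.2)) ∧
  ∀ i (hi : i < l.length),
    Bisimplicial (G.deleteEdges {e | e ∈ (l.take i).map fun p => s(p.1, p.2)})
      (l.get ⟨i, hi⟩).1 (l.get ⟨i, hi⟩).2

theorem add_one_mod_eq_or_iff {n i j : ℕ} (hi : i < n) (hj : j < n) :
    ((i + 1) % n = j ∨ (j + 1) % n = i) ↔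
      i + 1 = j ∨ j + 1 = i ∨ (i = 0 ∧ j + 1 = n) ∨ (j = 0 ∧ i + 1 = n) := by
  have key : ∀ k, k < n → (k + 1) % n = if k + 1 = n then 0 else k + 1 := by
    intro k hk
    split_ifs with h
    · rw [h, Nat.mod_self]
    · exact Nat.mod_eq_of_lt (by omega)
  rw [key i hi, key j hj]
  split_ifs <;> omega

theorem hasInducedCycle_iff {G : SimpleGraph V} {n : ℕ} :
    hasInducedCycle G n ↔ ∃ f : Fin n → V, Function.Injective f ∧
      ∀ i j : Fin n, G.Adj (f i) (f j) ↔
        i.val + 1 = j.val ∨ j.val + 1 = i.val ∨ (i.val = 0 ∧ j.val + 1 = n) ∨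
          (j.val = 0 ∧ i.val + 1 = n) := by
  simp only [hasInducedCycle, add_one_mod_eq_or_iff (Fin.is_lt _) (Fin.is_lt _)]

theorem exists_cycle_neighbors {n : ℕ} (hn : 5 ≤ n) (j : Fin n) :
    ∃ p q : Fin n, p ≠ q ∧ ∀ k : Fin n,
      (j.val + 1 = k.val ∨ k.val + 1 = j.val ∨ (j.val = 0 ∧ k.val + 1 = n) ∨
          (k.val = 0 ∧ j.val + 1 = n)) ↔ k = p ∨ k = q := by
  have hj := j.isLt
  refine ⟨⟨if j.val + 1 = n then 0 else j.val + 1, by split_ifs <;> omega⟩,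
    ⟨if j.val = 0 then n - 1 else j.val - 1, by split_ifs <;> omega⟩, ?_, ?_⟩
  · simp only [ne_eq, Fin.mk.injEq]
    split_ifs <;> omega
  · intro k
    have hk := k.isLt
    simp only [Fin.ext_iff]
    split_ifs <;> omega

/-- An edge of an induced cycle of length at least five is never bisimplicial, even after
deleting edges outside the cycle. -/
theorem not_bisimplicial_of_cycle {G H : SimpleGraph V} (hHG : H ≤ G) {n : ℕ} (hn : 5 ≤ n)
    {f : Fin n → V} (hf : Function.Injective f)
    (hG : ∀ i j : Fin n, G.Adj (f i) (f j) ↔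
      i.val + 1 = j.val ∨ j.val + 1 = i.val ∨ (i.val = 0 ∧ j.val + 1 = n) ∨
        (j.val = 0 ∧ i.val + 1 = n))
    (hH : ∀ i j : Fin n, G.Adj (f i) (f j) → H.Adj (f i) (f j)) (i j : Fin n) :
    ¬ Bisimplicial H (f i) (f j) := by
  rintro ⟨hij, hb⟩
  have hij' := (hG i j).1 (hHG hij)
  obtain ⟨p, hpj, hip⟩ : ∃ p, p ≠ j ∧ G.Adj (f i) (f p) := by
    obtain ⟨p, q, hpq, h⟩ := exists_cycle_neighbors hn i
    by_cases hp : p = j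
    · exact ⟨q, fun hq => hpq (hp.trans hq.symm), (hG _ _).2 ((h q).2 (Or.inr rfl))⟩
    · exact ⟨p, hp, (hG _ _).2 ((h p).2 (Or.inl rfl))⟩
  obtain ⟨q, hqi, hjq⟩ : ∃ q, q ≠ i ∧ G.Adj (f j) (f q) := by
    obtain ⟨p, q, hpq, h⟩ := exists_cycle_neighbors hn j
    by_cases hp : p = i
    · exact ⟨q, fun hq => hpq (hp.trans hq.symm), (hG _ _).2 ((h q).2 (Or.inr rfl))⟩
    · exact ⟨p, hp, (hG _ _).2 ((h p).2 (Or.inl rfl))⟩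
  have hip' := (hG i p).1 hip
  have hjq' := (hG j q).1 hjq
  rw [ne_eq, Fin.ext_iff] at hpj hqi
  have hi := i.isLt
  have hj := j.isLt
  have hp := p.isLt
  have hq := q.isLt
  have hpq : p ≠ q := by
    rw [ne_eq, Fin.ext_iff]
    omega
  have := (hG p q).1 (hHG (hb _ (hH _ _ hip) _ (hH _ _ hjq) (fun h => hpq (hf h))))
  omega

/-- Deleting a bisimplicial edge of a bipartite graph creates no long induced cycle. -/
theorem ChordalBipartite.deleteEdge {G : SimpleGraph V} {A B : Set V} (hbip : IsBipartition G A B)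
    (hc : ChordalBipartite G) {x y : V} (hxy : Bisimplicial G x y) :
    ChordalBipartite (G.deleteEdges {s(x, y)}) := by
  intro n hn hcyc
  rw [hasInducedCycle_iff] at hcyc
  obtain ⟨f, hf, hadj⟩ := hcyc
  by_cases hmem : (∃ i, f i = x) ∧ ∃ j, f j = y
  · obtain ⟨⟨i, rfl⟩, j, rfl⟩ := hmem
    have hne : i ≠ j := fun h => G.ne_of_adj hxy.1 (by rw [h])
    have hnij : ¬ (G.deleteEdges {s(f i, f j)}).Adj (f i) (f j) := by simp
    obtain ⟨a, _, -, hia⟩ := exists_cycle_neighbors hn i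
    obtain ⟨b, b', hbb, hjb⟩ := exists_cycle_neighbors hn j
    have hGia : (G.deleteEdges {s(f i, f j)}).Adj (f i) (f a) :=
      (hadj i a).2 ((hia a).2 (Or.inl rfl))
    have haj : a ≠ j := by
      rintro rfl
      exact hnij hGia
    have key : ∀ b, (G.deleteEdges {s(f i, f j)}).Adj (f j) (f b) →
        b ≠ i ∧ (G.deleteEdges {s(f i, f j)}).Adj (f a) (f b) := by
      intro b hjb
      have hbi : b ≠ i := by
        rintro rfl
        exact hnij hjb.symm
      refine ⟨hbi, ?_⟩
      have h1 : G.Adj (f i) (f a) := (G.deleteEdges_le _) hGia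
      have h2 : G.Adj (f j) (f b) := (G.deleteEdges_le _) hjb
      have hab : f a ≠ f b := by
        intro h
        rw [← h] at h2
        have k1 := hbip.2.2 h1
        have k2 := hbip.2.2 h2
        have k3 := hbip.2.2 hxy.1
        have d1 := hbip.2.1 (f i)
        have d2 := hbip.2.1 (f j)
        have d3 := hbip.2.1 (f a)
        tauto
      have hai : a ≠ i := fun h => G.ne_of_adj h1 (by rw [h])
      rw [SimpleGraph.deleteEdges_adj]
      refine ⟨hxy.2 _ h1 _ h2 hab, ?_⟩
      simp [hf.eq_iff, hai, haj]
    obtain ⟨hbi, hab⟩ := key b ((hadj j b).2 ((hjb b).2 (Or.inl rfl)))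
    obtain ⟨hbi', hab'⟩ := key b' ((hadj j b').2 ((hjb b').2 (Or.inr rfl)))
    have e1 := (hadj a b).1 hab
    have e2 := (hadj a b').1 hab'
    have e3 := (hadj i a).1 hGia
    rw [ne_eq, Fin.ext_iff] at hbi hbi' hbb
    omega
  · refine hc n hn (hasInducedCycle_iff.2 ⟨f, hf, fun i j => ?_⟩)
    rw [← hadj i j, SimpleGraph.deleteEdges_adj]
    refine ⟨fun h => ⟨h, fun he => hmem ?_⟩, fun h => h.1⟩
    rcases Sym2.eq_iff.1 (Set.mem_singleton_iff.1 he) with ⟨h1, h2⟩ | ⟨h1, h2⟩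
    · exact ⟨⟨i, h1⟩, j, h2⟩
    · exact ⟨⟨j, h2⟩, i, h1⟩

/-- The graph on all vertices keeping only the edges with both ends in `U`. -/
def edgesWithin (G : SimpleGraph V) (U : Set V) : SimpleGraph V where
  Adj u v := G.Adj u v ∧ u ∈ U ∧ v ∈ U
  symm := ⟨fun _ _ h => ⟨h.1.symm, h.2.2, h.2.1⟩⟩
  loopless := ⟨fun _ h => G.loopless.irrefl _ h.1⟩

theorem exists_geodesic {H : SimpleGraph V} {t s : V} (h : H.Reachable t s) :
    ∃ (m : ℕ) (f : ℕ → V), f 0 = t ∧ f m = s ∧ (∀ i < m, H.Adj (f i) (f (i + 1))) ∧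
      ∀ i ≤ m, H.dist t (f i) = i := by
  obtain ⟨p, hp⟩ := h.exists_walk_length_eq_dist
  refine ⟨p.length, p.getVert, p.getVert_zero, p.getVert_length,
    fun i hi => p.adj_getVert_succ hi, fun i hi => ?_⟩
  rw [← SimpleGraph.length_eq_dist_of_subwalk hp (p.isSubwalk_take i), SimpleGraph.Walk.take_length]
  omega

/-- A path from `t` to `s` whose interior avoids the neighbors of `x` and the common neighbors
of `s` and `t` yields, together with `x`, an induced cycle of length at least five. -/
theorem not_reachable_of_chordalBipartite {G : SimpleGraph V} (hc : ChordalBipartite G)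
    {x s t : V} (hxs : G.Adj x s) (hxt : G.Adj x t) (hst : s ≠ t) (hnst : ¬ G.Adj t s) :
    ¬ (edgesWithin G ({t, s} ∪ {v | v ≠ x ∧ ¬ G.Adj x v ∧ ¬ (G.Adj v s ∧ G.Adj v t)})).Reachable
      t s := by
  intro hr
  obtain ⟨m, f, h0, hm, hadj, hdist⟩ := exists_geodesic hr
  have hinj : ∀ i j, i ≤ m → j ≤ m → f i = f j → i = j := by
    intro i j hi hj h
    rw [← hdist i hi, ← hdist j hj, h]
  have hm0 : m ≠ 0 := by
    rintro rfl
    exact hst (hm.symm.trans h0)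
  have hmem : ∀ i ≤ m, f i ∈
      ({t, s} ∪ {v | v ≠ x ∧ ¬ G.Adj x v ∧ ¬ (G.Adj v s ∧ G.Adj v t)} : Set V) := by
    intro i hi
    rcases hi.lt_or_eq with hi | rfl
    · exact (hadj i hi).2.1
    · rw [hm]
      simp
  have hinner : ∀ i, 0 < i → i < m →
      f i ≠ x ∧ ¬ G.Adj x (f i) ∧ ¬ (G.Adj (f i) s ∧ G.Adj (f i) t) := by
    intro i hi him
    rcases hmem i him.le with (h | h) | h
    · have := hinj i 0 him.le (by omega) (h.trans h0.symm)
      omega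
    · have := hinj i m him.le le_rfl (h.trans hm.symm)
      omega
    · exact h
  have hnex : ∀ i ≤ m, f i ≠ x := by
    intro i hi
    by_cases hi0 : i = 0
    · rw [hi0, h0]
      exact hxt.ne'
    by_cases him : i = m
    · rw [him, hm]
      exact hxs.ne'
    exact (hinner i (by omega) (by omega)).1
  have hxf : ∀ i ≤ m, G.Adj x (f i) ↔ i = 0 ∨ i = m := by
    intro i hi
    constructor
    · intro h
      by_contra hcon
      exact (hinner i (by omega) (by omega)).2.1 h
    · rintro (rfl | rfl)
      · rwa [h0]
      · rwa [hm]
  have hff : ∀ i j, i ≤ m → j ≤ m → (G.Adj (f i) (f j) ↔ i + 1 = j ∨ j + 1 = i) := by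
    intro i j hi hj
    constructor
    · intro h
      have hH : (edgesWithin G _).Adj (f i) (f j) := ⟨h, hmem i hi, hmem j hj⟩
      have hne : i ≠ j := fun hij => h.ne (by rw [hij])
      have := hH.diff_dist_adj (u := t)
      rw [hdist i hi, hdist j hj] at this
      omega
    · rintro (rfl | rfl)
      · exact (hadj i (by omega)).1
      · exact (hadj j (by omega)).1.symm
  have hm3 : 3 ≤ m := by
    by_contra hlt
    obtain rfl | rfl : m = 1 ∨ m = 2 := by omega
    · exact hnst (h0 ▸ hm ▸ (hadj 0 (by omega)).1)
    · refine (hinner 1 (by omega) (by omega)).2.2 ⟨?_, ?_⟩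
      · rw [← hm]
        exact (hadj 1 (by omega)).1
      · rw [← h0]
        exact (hadj 0 (by omega)).1.symm
  refine hc (m + 2) (by omega) (hasInducedCycle_iff.2
    ⟨fun i => if i.val ≤ m then f i.val else x, ?_, ?_⟩)
  · intro i j h
    have hi := i.isLt
    have hj := j.isLt
    dsimp only at h
    rw [Fin.ext_iff]
    split_ifs at h with h1 h2 h2
    · exact hinj _ _ h1 h2 h
    · exact absurd h (hnex _ h1)
    · exact absurd h.symm (hnex _ h2)
    · omega
  · intro i j
    have hi := i.isLt
    have hj := j.isLt
    dsimp only
    split_ifs with h1 h2 h2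
    · rw [hff _ _ h1 h2]
      omega
    · rw [G.adj_comm, hxf _ h1]
      omega
    · rw [hxf _ h2]
      omega
    · simp only [SimpleGraph.irrefl, false_iff]
      omega

/-- Two vertices of `X` are linked if they have a common neighbor that is not adjacent to `x`. -/
def LinkedAvoiding (G : SimpleGraph V) (X : Finset V) (x a a' : V) : Prop :=
  a' ∈ X ∧ ∃ b, G.Adj a b ∧ G.Adj a' b ∧ ¬ G.Adj x b

theorem IsBipartition.not_adj_left {G : SimpleGraph V} {A B : Set V} (h : IsBipartition G A B)
    {a a' : V} (ha : a ∈ A) (ha' : a' ∈ A) : ¬ G.Adj a a' := by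
  intro hadj
  have h1 := h.2.1 a
  have h2 := h.2.1 a'
  have h3 := h.2.2 hadj
  tauto

theorem IsBipartition.mem_right {G : SimpleGraph V} {A B : Set V} (h : IsBipartition G A B)
    {a b : V} (ha : a ∈ A) (hadj : G.Adj a b) : b ∈ B := by
  have h1 := h.2.1 a
  have h3 := h.2.2 hadj
  tauto

theorem IsBipartition.swap {G : SimpleGraph V} {A B : Set V} (h : IsBipartition G A B) :
    IsBipartition G B A :=
  ⟨fun v => (h.1 v).symm, fun v hv => h.2.1 v hv.symm, fun _ _ hxy => (h.2.2 hxy).symm⟩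

/-- If `c` maximizes the trace of its neighborhood on `N(x)`, then that trace contains the trace
of every vertex that can be reached from `c` while avoiding `N(x)`. -/
theorem trace_subset_of_linked {G : SimpleGraph V} {A B : Set V}
    (hbip : IsBipartition G A B) (hc : ChordalBipartite G) {X : Finset V} (hXA : ∀ a ∈ X, a ∈ A)
    {x c : V} (hx : x ∈ X) (hcX : c ∈ X) {b₀ : V} (hcb : G.Adj c b₀) (hxb : ¬ G.Adj x b₀)
    (hmax : ∀ a ∈ X, (∃ b, G.Adj a b ∧ ¬ G.Adj x b) →
      ∀ s, G.Adj a s → G.Adj x s → ¬ G.Adj c s → ∃ t, G.Adj c t ∧ G.Adj x t ∧ ¬ G.Adj a t)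
    {a : V} (ha : Relation.ReflTransGen (LinkedAvoiding G X x) c a) :
    ∀ s, G.Adj a s → G.Adj x s → G.Adj c s := by
  have hxA := hXA x hx
  suffices h : a ∈ X ∧ (∀ s, G.Adj a s → G.Adj x s → G.Adj c s) ∧
      ∀ s t, G.Adj x s → G.Adj x t → G.Adj c t → ¬ G.Adj c s →
        (edgesWithin G ({t, s} ∪
          {v | v ≠ x ∧ ¬ G.Adj x v ∧ ¬ (G.Adj v s ∧ G.Adj v t)})).Reachable t a from h.2.1
  induction ha with
  | refl =>
    refine ⟨hcX, fun s h _ => h, fun s t hxs hxt hct hcs => SimpleGraph.Adj.reachable ?_⟩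
    refine ⟨hct.symm, by simp, Or.inr ⟨?_, hbip.not_adj_left hxA (hXA c hcX), fun h => hcs h.1⟩⟩
    rintro rfl
    exact hxb hcb
  | @tail a a' _ hlink ih =>
    obtain ⟨haX, htr, hreach⟩ := ih
    obtain ⟨haX', b, hab, hab', hnxb⟩ := hlink
    have hbB := hbip.mem_right (hXA a haX) hab
    have hstep : ∀ s t, G.Adj x s → G.Adj x t → G.Adj c t → ¬ G.Adj c s →
        ¬ (G.Adj a' s ∧ G.Adj a' t) →
        a' ∈ ({t, s} ∪ {v | v ≠ x ∧ ¬ G.Adj x v ∧ ¬ (G.Adj v s ∧ G.Adj v t)} : Set V) ∧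
        (edgesWithin G ({t, s} ∪
          {v | v ≠ x ∧ ¬ G.Adj x v ∧ ¬ (G.Adj v s ∧ G.Adj v t)})).Reachable t a' := by
      intro s t hxs hxt hct hcs hnot
      have hsB := hbip.mem_right hxA hxs
      have hbU : b ∈ ({t, s} ∪
          {v | v ≠ x ∧ ¬ G.Adj x v ∧ ¬ (G.Adj v s ∧ G.Adj v t)} : Set V) := by
        refine Or.inr ⟨?_, hnxb, fun h => hbip.swap.not_adj_left hbB hsB h.1⟩
        rintro rfl
        exact hbip.2.1 _ ⟨hxA, hbB⟩
      have haU' : a' ∈ ({t, s} ∪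
          {v | v ≠ x ∧ ¬ G.Adj x v ∧ ¬ (G.Adj v s ∧ G.Adj v t)} : Set V) := by
        refine Or.inr ⟨?_, hbip.not_adj_left hxA (hXA a' haX'), hnot⟩
        rintro rfl
        exact hnxb hab'
      have haU : a ∈ ({t, s} ∪
          {v | v ≠ x ∧ ¬ G.Adj x v ∧ ¬ (G.Adj v s ∧ G.Adj v t)} : Set V) := by
        refine Or.inr ⟨?_, hbip.not_adj_left hxA (hXA a haX), fun h => hcs (htr s h.1 hxs)⟩
        rintro rfl
        exact hnxb hab
      refine ⟨haU', (hreach s t hxs hxt hct hcs).trans ?_⟩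
      have e1 : (edgesWithin G ({t, s} ∪
          {v | v ≠ x ∧ ¬ G.Adj x v ∧ ¬ (G.Adj v s ∧ G.Adj v t)})).Adj a b := ⟨hab, haU, hbU⟩
      have e2 : (edgesWithin G ({t, s} ∪
          {v | v ≠ x ∧ ¬ G.Adj x v ∧ ¬ (G.Adj v s ∧ G.Adj v t)})).Adj b a' :=
        ⟨hab'.symm, hbU, haU'⟩
      exact e1.reachable.trans e2.reachable
    have htr' : ∀ s, G.Adj a' s → G.Adj x s → G.Adj c s := by
      intro s has hxs
      by_contra hcs
      obtain ⟨t, hct, hxt, hat⟩ := hmax a' haX' ⟨b, hab', hnxb⟩ s has hxs hcs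
      obtain ⟨haU', hr⟩ := hstep s t hxs hxt hct hcs (fun h => hat h.2)
      refine not_reachable_of_chordalBipartite hc hxs hxt ?_ ?_ (hr.trans
        (SimpleGraph.Adj.reachable ⟨has, haU', by simp⟩))
      · rintro rfl
        exact hcs hct
      · exact hbip.swap.not_adj_left (hbip.mem_right hxA hxt) (hbip.mem_right hxA hxs)
    exact ⟨haX', htr', fun s t hxs hxt hct hcs =>
      (hstep s t hxs hxt hct hcs (fun h => hcs (htr' s h.1 hxs))).2⟩

open Classical in
/-- In a chordal bipartite graph, if some edge has its right end outside `N(x)`, then some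
bisimplicial edge does; here the left color class is restricted to `X`. -/
theorem exists_bisimplicial_avoiding [Fintype V] {G : SimpleGraph V} {A B : Set V}
    (hbip : IsBipartition G A B) (hc : ChordalBipartite G) (X : Finset V)
    (hXA : ∀ a ∈ X, a ∈ A) (x : V) (hx : x ∈ X)
    (hex : ∃ a ∈ X, ∃ b, G.Adj a b ∧ ¬ G.Adj x b) :
    ∃ a ∈ X, ∃ b, G.Adj a b ∧ ¬ G.Adj x b ∧
      ∀ a' ∈ X, G.Adj a' b → ∀ b', G.Adj a b' → G.Adj a' b' := by
  induction hk : X.card using Nat.strong_induction_on generalizing X x with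
  | _ k ih =>
    obtain ⟨c, hcY, hcmax⟩ := Finset.exists_max_image
      (X.filter fun a => ∃ b, G.Adj a b ∧ ¬ G.Adj x b)
      (fun a => (Finset.univ.filter fun s => G.Adj a s ∧ G.Adj x s).card)
      (by
        obtain ⟨a, ha, hb⟩ := hex
        exact ⟨a, Finset.mem_filter.2 ⟨ha, hb⟩⟩)
    obtain ⟨hcX, b₀, hcb, hxb⟩ := Finset.mem_filter.1 hcY
    have hmax : ∀ a ∈ X, (∃ b, G.Adj a b ∧ ¬ G.Adj x b) → ∀ s, G.Adj a s → G.Adj x s →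
        ¬ G.Adj c s → ∃ t, G.Adj c t ∧ G.Adj x t ∧ ¬ G.Adj a t := by
      intro a ha hab s has hxs hcs
      by_contra! hcon
      refine (hcmax a (Finset.mem_filter.2 ⟨ha, hab⟩)).not_gt (Finset.card_lt_card ?_)
      rw [Finset.ssubset_iff_of_subset]
      · exact ⟨s, by simp [has, hxs], by simp [hcs]⟩
      · intro t ht
        simp only [Finset.mem_filter, Finset.mem_univ, true_and] at ht ⊢
        exact ⟨hcon t ht.1 ht.2, ht.2⟩
    set C := X.filter fun a => Relation.ReflTransGen (LinkedAvoiding G X x) c a with hC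
    have hCX : ∀ a ∈ C, a ∈ X := fun a ha => (Finset.mem_filter.1 ha).1
    have hcC : c ∈ C := Finset.mem_filter.2 ⟨hcX, Relation.ReflTransGen.refl⟩
    have htrace : ∀ a ∈ C, ∀ s, G.Adj a s → G.Adj x s → G.Adj c s := fun a ha =>
      trace_subset_of_linked hbip hc hXA hx hcX hcb hxb hmax (Finset.mem_filter.1 ha).2
    have hclosed : ∀ a ∈ C, ∀ b, G.Adj a b → ¬ G.Adj x b → ∀ a' ∈ X, G.Adj a' b → a' ∈ C :=
      fun a ha b hab hxb a' ha' hab' => Finset.mem_filter.2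
        ⟨ha', (Finset.mem_filter.1 ha).2.tail ⟨ha', b, hab, hab', hxb⟩⟩
    have hxC : x ∉ C := by
      intro h
      rcases Relation.ReflTransGen.cases_tail (Finset.mem_filter.1 h).2 with h | ⟨a, -, h⟩
      · exact hxb (h ▸ hcb)
      · obtain ⟨-, b, -, h1, h2⟩ := h
        exact h2 h1
    have hcard : C.card < X.card :=
      Finset.card_lt_card ((Finset.ssubset_iff_of_subset hCX).2 ⟨x, hx, hxC⟩)
    by_cases h1 : ∃ a ∈ C, ∃ b, G.Adj a b ∧ ¬ G.Adj c b
    · obtain ⟨a, ha, b, hab, hcb', hmin⟩ :=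
        ih C.card (hk ▸ hcard) C (fun a ha => hXA a (hCX a ha)) c hcC h1 rfl
      have hxb' : ¬ G.Adj x b := fun h => hcb' (htrace a ha b hab h)
      exact ⟨a, hCX a ha, b, hab, hxb', fun a' ha' hab' =>
        hmin a' (hclosed a ha b hab hxb' a' ha' hab') hab'⟩
    push Not at h1
    by_cases h2 : ∃ a ∈ C.erase c, ∃ b, G.Adj a b ∧ ¬ G.Adj x b
    · have hcard' : (insert x (C.erase c)).card < k := by
        rw [Finset.card_insert_of_notMem (fun h => hxC (Finset.mem_of_mem_erase h)),
          Finset.card_erase_add_one hcC, ← hk]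
        exact hcard
      obtain ⟨a, ha, b, hab, hxb', hmin⟩ := ih _ hcard' (insert x (C.erase c))
        (by
          intro a ha
          rcases Finset.mem_insert.1 ha with rfl | ha
          · exact hXA _ hx
          · exact hXA a (hCX a (Finset.mem_of_mem_erase ha)))
        x (Finset.mem_insert_self _ _)
        (by
          obtain ⟨a, ha, h⟩ := h2
          exact ⟨a, Finset.mem_insert_of_mem ha, h⟩) rfl
      have haC : a ∈ C := by
        rcases Finset.mem_insert.1 ha with rfl | ha
        · exact absurd hab hxb'
        · exact Finset.mem_of_mem_erase ha
      refine ⟨a, hCX a haC, b, hab, hxb', fun a' ha' hab' b' hb' => ?_⟩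
      by_cases hac : a' = c
      · exact hac ▸ h1 a haC b' hb'
      · exact hmin a' (Finset.mem_insert_of_mem (Finset.mem_erase.2
          ⟨hac, hclosed a haC b hab hxb' a' ha' hab'⟩)) hab' b' hb'
    · push Not at h2
      refine ⟨c, hcX, b₀, hcb, hxb, fun a' ha' hab' b' hb' => ?_⟩
      by_cases hac : a' = c
      · exact hac ▸ hb'
      · exact absurd (h2 a' (Finset.mem_erase.2
          ⟨hac, hclosed c hcC b₀ hcb hxb a' ha' hab'⟩) b₀ hab') hxb

open Classical in
/-- A chordal bipartite graph with an edge has a bisimplicial edge. -/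
theorem ChordalBipartite.exists_bisimplicial [Fintype V] {G : SimpleGraph V} {A B : Set V}
    (hbip : IsBipartition G A B) (hc : ChordalBipartite G) (hG : ∃ x y, G.Adj x y) :
    ∃ x y, Bisimplicial G x y := by
  obtain ⟨x, y, hx, hxy⟩ : ∃ x y, x ∈ A ∧ G.Adj x y := by
    obtain ⟨x, y, hxy⟩ := hG
    rcases hbip.2.2 hxy with h | h
    · exact ⟨x, y, h.1, hxy⟩
    · exact ⟨y, x, h.2, hxy.symm⟩
  have hmemA : ∀ a b, b ∈ B → G.Adj b a → a ∈ A := fun a b hb h => hbip.swap.mem_right hb h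
  by_cases h : ∃ z ∈ A, ∃ a ∈ A, ∃ b, G.Adj a b ∧ ¬ G.Adj z b
  · obtain ⟨z, hz, a, ha, b, hab⟩ := h
    obtain ⟨a, ha, b, hab, -, hmin⟩ := exists_bisimplicial_avoiding hbip hc
      (Finset.univ.filter (· ∈ A)) (by simp) z (by simpa using hz) ⟨a, by simpa using ha, b, hab⟩
    simp only [Finset.mem_filter, Finset.mem_univ, true_and] at ha hmin
    exact ⟨a, b, hab, fun b' hb' a' ha' _ =>
      (hmin a' (hmemA _ _ (hbip.mem_right ha hab) ha') (SimpleGraph.Adj.symm ha') b' hb').symm⟩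
  · push Not at h
    exact ⟨x, y, hxy, fun b' hb' a' ha' _ =>
      (h a' (hmemA _ _ (hbip.mem_right hx hxy) ha') x hx b' hb').symm⟩

theorem IsBipartition.mono {G H : SimpleGraph V} {A B : Set V} (h : IsBipartition G A B)
    (hHG : H ≤ G) : IsBipartition H A B :=
  ⟨h.1, h.2.1, fun _ _ hxy => h.2.2 (hHG hxy)⟩

theorem PerfectEdgeElimOrdering.cons {G : SimpleGraph V} {x y : V} (hxy : Bisimplicial G x y)
    {l : List (V × V)} (hl : PerfectEdgeElimOrdering (G.deleteEdges {s(x, y)}) l) :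
    PerfectEdgeElimOrdering G ((x, y) :: l) := by
  obtain ⟨hnd, hmem, hbis⟩ := hl
  refine ⟨?_, fun e => ?_, fun i hi => ?_⟩
  · rw [List.map_cons, List.nodup_cons]
    refine ⟨fun h => ?_, hnd⟩
    have := (hmem _).2 h
    simp at this
  · rw [List.map_cons, List.mem_cons, ← hmem, SimpleGraph.edgeSet_deleteEdges]
    by_cases he : e = s(x, y)
    · simp [he, hxy.1]
    · simp [he]
  · cases i with
    | zero => simpa using hxy
    | succ i =>
      have := hbis i (by simpa using hi)
      rw [SimpleGraph.deleteEdges_deleteEdges] at this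
      convert this using 2
      · ext e
        simp
      · rfl
      · rfl

theorem ChordalBipartite.exists_perfectEdgeElimOrdering [Fintype V] {G : SimpleGraph V}
    {A B : Set V} (hbip : IsBipartition G A B) (hc : ChordalBipartite G) :
    ∃ l : List (V × V), PerfectEdgeElimOrdering G l := by
  induction hk : G.edgeSet.ncard using Nat.strong_induction_on generalizing G with
  | _ k ih =>
    by_cases hG : ∃ x y, G.Adj x y
    · obtain ⟨x, y, hxy⟩ := hc.exists_bisimplicial hbip hG
      have hlt : (G.deleteEdges {s(x, y)}).edgeSet.ncard < k := by
        rw [← hk, SimpleGraph.edgeSet_deleteEdges]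
        exact Set.ncard_sdiff_singleton_lt_of_mem hxy.1 (Set.toFinite _)
      obtain ⟨l, hl⟩ := ih _ hlt (hbip.mono (G.deleteEdges_le _)) (hc.deleteEdge hbip hxy) rfl
      exact ⟨_, hl.cons hxy⟩
    · refine ⟨[], by simp, fun e => ?_, by simp⟩
      induction e with
      | _ x y => simpa using fun h => hG ⟨x, y, h⟩

theorem PerfectEdgeElimOrdering.chordalBipartite {G : SimpleGraph V} {l : List (V × V)}
    (hl : PerfectEdgeElimOrdering G l) : ChordalBipartite G := by
  classical
  intro n hn hcyc
  obtain ⟨f, hf, hadj⟩ := hasInducedCycle_iff.1 hcyc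
  obtain ⟨-, hmem, hbis⟩ := hl
  have hex : ∃ i, ∃ hi : i < l.length, ∃ j k, s(l[i].1, l[i].2) = s(f j, f k) := by
    have h01 : G.Adj (f ⟨0, by omega⟩) (f ⟨1, by omega⟩) := (hadj _ _).2 (Or.inl rfl)
    obtain ⟨p, hp, he⟩ := List.mem_map.1 ((hmem s(_, _)).1 h01)
    obtain ⟨i, hi, rfl⟩ := List.mem_iff_getElem.1 hp
    exact ⟨i, hi, _, _, he⟩
  obtain ⟨hi, j, k, he⟩ := Nat.find_spec hex
  have hb := hbis _ hi
  have hkeep : ∀ p q : Fin n, G.Adj (f p) (f q) → (G.deleteEdges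
      {e | e ∈ (l.take (Nat.find hex)).map fun p => s(p.1, p.2)}).Adj (f p) (f q) := by
    intro p q hpq
    refine SimpleGraph.deleteEdges_adj.2 ⟨hpq, fun hmem => ?_⟩
    obtain ⟨e, he, heq⟩ := List.mem_map.1 hmem
    obtain ⟨m, hm, rfl⟩ := List.mem_iff_getElem.1 he
    rw [List.length_take] at hm
    refine Nat.find_min hex (m := m) (by omega) ⟨by omega, p, q, ?_⟩
    simpa using heq
  have hnot := not_bisimplicial_of_cycle (G.deleteEdges_le _) hn hf hadj hkeep
  simp only [List.get_eq_getElem] at hb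
  rcases Sym2.eq_iff.1 he with ⟨h1, h2⟩ | ⟨h1, h2⟩
  · rw [h1, h2] at hb
    exact hnot j k hb
  · rw [h1, h2] at hb
    exact hnot k j hb

/-- A bipartite graph is chordal bipartite iff it has a perfect edge without vertex
elimination ordering. -/
theorem chordalBipartite_iff_perfectEdgeElimOrdering [Fintype V]
    (G : SimpleGraph V) (A B : Set V) (hbip : IsBipartition G A B) :
    ChordalBipartite G ↔ ∃ l : List (V × V), PerfectEdgeElimOrdering G l := by
  exact ⟨fun hc => hc.exists_perfectEdgeElimOrdering hbip, fun ⟨_, hl⟩ => hl.chordalBipartite⟩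
end

section
/- A bipartite graph G = (A,B,E) is chordal bipartite if and only if the graph G_A, obtained from G by adding an edge between every pair of distinct vertices of A, is strongly chordal. -/
variable {V : Type*}

/-- A graph is chordal if it has no induced cycle of length more than three. -/
def IsChordalGraph (G : SimpleGraph V) : Prop :=
  ∀ n, 4 ≤ n → ¬ hasInducedCycle G n

/-- `G` contains an induced `k`-sun: vertices `c 0, …, c (k-1)` inducing a clique and
vertices `s 0, …, s (k-1)` where `s i` is adjacent exactly to `c i` and `c (i+1)` (mod `k`). -/
def HasInducedSun (G : SimpleGraph V) (k : ℕ) : Prop :=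
  ∃ c s : Fin k → V, Function.Injective c ∧ Function.Injective s ∧
    (∀ i j, c i ≠ s j) ∧
    (∀ i j, i ≠ j → G.Adj (c i) (c j)) ∧
    (∀ i j : Fin k, G.Adj (s i) (c j) ↔ (j.val = i.val ∨ j.val = (i.val + 1) % k)) ∧
    ∀ i j, ¬ G.Adj (s i) (s j)

/-- A graph is strongly chordal if it is chordal and has no induced `k`-sun, `k ≥ 3`. -/
def StronglyChordal (G : SimpleGraph V) : Prop :=
  IsChordalGraph G ∧ ∀ k, 3 ≤ k → ¬ HasInducedSun G k

/-- The graph obtained from `G` by adding an edge between every pair of distinct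
vertices of `A`. -/
def addCompleteOn (G : SimpleGraph V) (A : Set V) : SimpleGraph V :=
  SimpleGraph.fromRel fun u v => G.Adj u v ∨ (u ∈ A ∧ v ∈ A)

theorem succ_mod_eq_iff {n i j : ℕ} (hi : i < n) :
    (i + 1) % n = j ↔ (i + 1 = n ∧ j = 0) ∨ (i + 1 < n ∧ j = i + 1) := by
  rcases Nat.lt_or_ge (i + 1) n with h | h
  · rw [Nat.mod_eq_of_lt h]; omega
  · obtain rfl : n = i + 1 := by omega
    rw [Nat.mod_self]; omega

theorem addCompleteOn_adj {G : SimpleGraph V} {A : Set V} {u v : V} :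
    (addCompleteOn G A).Adj u v ↔ G.Adj u v ∨ (u ≠ v ∧ u ∈ A ∧ v ∈ A) := by
  have h : G.Adj u v → u ≠ v := fun h => h.ne
  have h' := G.adj_comm u v
  simp only [addCompleteOn, SimpleGraph.fromRel_adj]
  tauto

/-- Adjacency on an induced cycle, with the cyclic successor unfolded. -/
theorem inducedCycle_adj_iff {G : SimpleGraph V} {n : ℕ} {f : Fin n → V}
    (hf : ∀ i j : Fin n, G.Adj (f i) (f j) ↔
      ((i.val + 1) % n = j.val ∨ (j.val + 1) % n = i.val))
    {i j : ℕ} (hi : i < n) (hj : j < n) :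
    G.Adj (f ⟨i, hi⟩) (f ⟨j, hj⟩) ↔
      i + 1 = j ∨ j + 1 = i ∨ (i + 1 = n ∧ j = 0) ∨ (j + 1 = n ∧ i = 0) := by
  rw [hf, succ_mod_eq_iff hi, succ_mod_eq_iff hj]
  dsimp only
  omega

namespace IsBipartition

variable {G : SimpleGraph V} {A B : Set V}

theorem mem_right_iff (h : IsBipartition G A B) {v : V} : v ∈ B ↔ v ∉ A := by
  have h1 := h.1 v
  have h2 := h.2.1 v
  tauto

theorem mem_left_iff_of_adj (h : IsBipartition G A B) {u v : V} (huv : G.Adj u v) :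
    u ∈ A ↔ v ∉ A := by
  have h1 := h.2.2 huv
  simp only [h.mem_right_iff] at h1
  tauto

theorem not_addCompleteOn_adj (h : IsBipartition G A B) {u v : V} (hu : u ∉ A) (hv : v ∉ A) :
    ¬ (addCompleteOn G A).Adj u v := by
  rw [addCompleteOn_adj]
  rintro (huv | huv)
  · exact hu ((h.mem_left_iff_of_adj huv).2 hv)
  · exact hu huv.2.1

/-- The vertices of a cycle alternate between the two color classes. -/
theorem cycle_mem_left_iff (h : IsBipartition G A B) {n : ℕ} {f : Fin n → V}
    (hf : ∀ i j : Fin n, G.Adj (f i) (f j) ↔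
      ((i.val + 1) % n = j.val ∨ (j.val + 1) % n = i.val))
    (hn : 0 < n) (h0 : f ⟨0, hn⟩ ∈ A) (i : ℕ) (hi : i < n) :
    f ⟨i, hi⟩ ∈ A ↔ i % 2 = 0 := by
  induction i with
  | zero => simpa using h0
  | succ i ih =>
    have hadj := (inducedCycle_adj_iff hf (by omega : i < n) hi).2 (Or.inl rfl)
    have h1 := h.mem_left_iff_of_adj hadj
    rw [ih (by omega)] at h1
    rw [← not_iff_not, ← h1]
    omega

/-- An induced cycle of `G` that starts in `A` spans an induced sun of `G_A`. -/
theorem hasInducedSun_of_inducedCycle (h : IsBipartition G A B) {n : ℕ} (hn : 5 ≤ n)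
    {f : Fin n → V} (hinj : Function.Injective f)
    (hf : ∀ i j : Fin n, G.Adj (f i) (f j) ↔
      ((i.val + 1) % n = j.val ∨ (j.val + 1) % n = i.val))
    (h0 : f ⟨0, by omega⟩ ∈ A) :
    ∃ k, 3 ≤ k ∧ HasInducedSun (addCompleteOn G A) k := by
  have hmem := h.cycle_mem_left_iff hf (by omega) h0
  have heven : n % 2 = 0 := by
    have hadj := (inducedCycle_adj_iff hf (by omega : n - 1 < n) (by omega : 0 < n)).2 (by omega)
    have h1 := h.mem_left_iff_of_adj hadj
    rw [hmem, hmem] at h1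
    omega
  obtain ⟨k, rfl⟩ : ∃ k, n = 2 * k := ⟨n / 2, by omega⟩
  have hinj' : ∀ {i j : ℕ} {hi : i < 2 * k} {hj : j < 2 * k}, f ⟨i, hi⟩ = f ⟨j, hj⟩ → i = j :=
    fun e => congrArg Fin.val (hinj e)
  refine ⟨k, by omega, fun i => f ⟨2 * i, by omega⟩, fun i => f ⟨2 * i + 1, by omega⟩,
    ?_, ?_, ?_, ?_, ?_, ?_⟩
  · intro i j e
    have := hinj' e
    omega
  · intro i j e
    have := hinj' e
    omega
  · intro i j e
    have := hinj' e
    omega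
  · intro i j hij
    refine addCompleteOn_adj.2 (Or.inr ⟨fun e => ?_, (hmem _ _).2 (by omega),
      (hmem _ _).2 (by omega)⟩)
    have := hinj' e
    omega
  · intro i j
    have hs : f ⟨2 * i + 1, by omega⟩ ∉ A := by
      rw [hmem]
      omega
    rw [addCompleteOn_adj, inducedCycle_adj_iff hf, @eq_comm _ j.val ((i.val + 1) % k),
      succ_mod_eq_iff i.isLt]
    simp only [hs, false_and, and_false, or_false]
    omega
  · intro i j
    apply h.not_addCompleteOn_adj
    · rw [hmem]
      omega
    · rw [hmem]
      omega

theorem isChordalGraph_addCompleteOn (h : IsBipartition G A B) :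
    IsChordalGraph (addCompleteOn G A) := by
  rintro n hn ⟨f, hinj, hf⟩
  have hclique : ∀ {i j : ℕ} (hi : i < n) (hj : j < n), i ≠ j →
      f ⟨i, hi⟩ ∈ A → f ⟨j, hj⟩ ∈ A →
      i + 1 = j ∨ j + 1 = i ∨ (i + 1 = n ∧ j = 0) ∨ (j + 1 = n ∧ i = 0) := by
    intro i j hi hj hij hiA hjA
    refine (inducedCycle_adj_iff hf hi hj).1 (addCompleteOn_adj.2 (Or.inr ⟨fun e => ?_, hiA, hjA⟩))
    exact hij (congrArg Fin.val (hinj e))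
  have hcover : ∀ {i j : ℕ} (hi : i < n) (hj : j < n),
      i + 1 = j ∨ j + 1 = i ∨ (i + 1 = n ∧ j = 0) ∨ (j + 1 = n ∧ i = 0) →
      f ⟨i, hi⟩ ∉ A → f ⟨j, hj⟩ ∈ A := by
    intro i j hi hj hij hiA
    by_contra hjA
    exact h.not_addCompleteOn_adj hiA hjA ((inducedCycle_adj_iff hf hi hj).2 hij)
  have h0 : 0 < n := by omega
  have h1 : 1 < n := by omega
  have h2 : 2 < n := by omega
  have h3 : 3 < n := by omega
  by_cases a2 : f ⟨2, h2⟩ ∈ A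
  · have a0 : f ⟨0, h0⟩ ∉ A := fun a0 => by
      have := hclique h0 h2 (by omega) a0 a2
      omega
    have a1 := hcover h0 h1 (by omega) a0
    have a3 : f ⟨3, h3⟩ ∉ A := fun a3 => by
      have := hclique h1 h3 (by omega) a1 a3
      omega
    rcases Nat.lt_or_ge 4 n with h4 | h4
    · have a4 := hcover h3 h4 (by omega) a3
      have := hclique h2 h4 (by omega) a2 a4
      omega
    · exact a0 (hcover h3 h0 (by omega) a3)
  · have := hclique h1 h3 (by omega) (hcover h2 h1 (by omega) a2) (hcover h2 h3 (by omega) a2)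
    omega

/-- A sun of `G_A` is a cycle of `G` in which the two parts of the sun alternate. -/
theorem hasInducedCycle_of_hasInducedSun (h : IsBipartition G A B) {k : ℕ} (hk : 3 ≤ k)
    (hsun : HasInducedSun (addCompleteOn G A) k) : hasInducedCycle G (2 * k) := by
  obtain ⟨c, s, hc, hs, hcs, hcc, hsc, hss⟩ := hsun
  have hsc' : ∀ i j : Fin k, (addCompleteOn G A).Adj (s i) (c j) ↔
      j.val = i.val ∨ (i.val + 1 = k ∧ j.val = 0) ∨ (i.val + 1 < k ∧ j.val = i.val + 1) := by
    intro i j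
    rw [hsc, @eq_comm _ j.val ((i.val + 1) % k), succ_mod_eq_iff i.isLt]
  have hcA : ∀ i, c i ∈ A := by
    intro i
    by_contra hi
    have key : ∀ j, (addCompleteOn G A).Adj (s j) (c i) → s j ∈ A := fun j hj => by
      by_contra hjA
      exact h.not_addCompleteOn_adj hjA hi hj
    obtain ⟨j, hji, hj⟩ : ∃ j, j ≠ i ∧ (addCompleteOn G A).Adj (s j) (c i) := by
      rcases Nat.eq_zero_or_pos i.val with hi0 | hi0
      · refine ⟨⟨k - 1, by omega⟩, fun e => ?_, (hsc' _ _).2 (by dsimp only; omega)⟩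
        have := congrArg Fin.val e
        dsimp only at this
        omega
      · refine ⟨⟨i.val - 1, by omega⟩, fun e => ?_, (hsc' _ _).2 (by dsimp only; omega)⟩
        have := congrArg Fin.val e
        dsimp only at this
        omega
    exact hss j i (addCompleteOn_adj.2 (Or.inr ⟨fun e => hji (hs e), key j hj,
      key i ((hsc' i i).2 (Or.inl rfl))⟩))
  have hsA : ∀ i, s i ∉ A := by
    intro i hi
    have key : ∀ j, (addCompleteOn G A).Adj (s i) (c j) := fun j =>
      addCompleteOn_adj.2 (Or.inr ⟨(hcs j i).symm, hi, hcA j⟩)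
    have k0 := (hsc' _ _).1 (key ⟨0, by omega⟩)
    have k1 := (hsc' _ _).1 (key ⟨1, by omega⟩)
    have k2 := (hsc' _ _).1 (key ⟨2, by omega⟩)
    dsimp only at k0 k1 k2
    omega
  have hcc' : ∀ i j, ¬ G.Adj (c i) (c j) := fun i j hij =>
    (h.mem_left_iff_of_adj hij).1 (hcA i) (hcA j)
  have hss' : ∀ i j, ¬ G.Adj (s i) (s j) := fun i j hij =>
    hss i j (addCompleteOn_adj.2 (Or.inl hij))
  have hsc'' : ∀ i j : Fin k, G.Adj (s i) (c j) ↔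
      j.val = i.val ∨ (i.val + 1 = k ∧ j.val = 0) ∨ (i.val + 1 < k ∧ j.val = i.val + 1) := by
    intro i j
    rw [← hsc', addCompleteOn_adj]
    simp only [hsA i, false_and, and_false, or_false]
  refine ⟨fun m => if m.val % 2 = 0 then c ⟨m.val / 2, by omega⟩ else s ⟨m.val / 2, by omega⟩,
    ?_, ?_⟩
  · intro i j e
    dsimp only at e
    split_ifs at e with hi hj hj
    · have := congrArg Fin.val (hc e)
      dsimp only at this
      omega
    · exact absurd e (hcs _ _)
    · exact absurd e.symm (hcs _ _)
    · have := congrArg Fin.val (hs e)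
      dsimp only at this
      omega
  · intro i j
    rw [succ_mod_eq_iff i.isLt, succ_mod_eq_iff j.isLt]
    dsimp only
    split_ifs with hi hj hj
    · simp only [hcc', false_iff]
      omega
    · rw [G.adj_comm, hsc'']
      dsimp only
      omega
    · rw [hsc'']
      dsimp only
      omega
    · simp only [hss', false_iff]
      omega

end IsBipartition

/-- A bipartite graph `G = (A, B, E)` is chordal bipartite iff `G_A`, obtained by adding an
edge between every pair of distinct vertices of `A`, is strongly chordal. -/
theorem chordalBipartite_iff_stronglyChordal_addCompleteOn [Fintype V]
    (G : SimpleGraph V) (A B : Set V) (hbip : IsBipartition G A B) :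
    ChordalBipartite G ↔ StronglyChordal (addCompleteOn G A) := by
  constructor
  · exact fun hG => ⟨hbip.isChordalGraph_addCompleteOn, fun k hk hsun =>
      hG (2 * k) (by omega) (hbip.hasInducedCycle_of_hasInducedSun hk hsun)⟩
  · rintro ⟨-, hG⟩ n hn ⟨f, hinj, hf⟩
    suffices ∃ k, 3 ≤ k ∧ HasInducedSun (addCompleteOn G A) k by
      obtain ⟨k, hk, hsun⟩ := this
      exact hG k hk hsun
    by_cases h0 : f ⟨0, by omega⟩ ∈ A
    · exact hbip.hasInducedSun_of_inducedCycle hn hinj hf h0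
    · refine hbip.hasInducedSun_of_inducedCycle hn (f := f ∘ Fin.rev)
        (hinj.comp Fin.rev_injective) (fun i j => ?_) ?_
      · rw [succ_mod_eq_iff i.isLt, succ_mod_eq_iff j.isLt, Function.comp_apply,
          Function.comp_apply, hf, succ_mod_eq_iff i.rev.isLt, succ_mod_eq_iff j.rev.isLt,
          Fin.val_rev, Fin.val_rev]
        omega
      · have hadj := (inducedCycle_adj_iff hf (by omega : n - 1 < n) (by omega : 0 < n)).2
          (by omega)
        exact (hbip.mem_left_iff_of_adj hadj).2 h0
end

section
/- A finite graph is strongly chordal if and only if every nonempty induced subgraph has a simple vertex. -/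
variable {V : Type*}

/-- The closed neighborhood `N[v]`. -/
def closedNbhd (G : SimpleGraph V) (v : V) : Set V := insert v (G.neighborSet v)

/-- A vertex `x` is simple if `N[x]` can be ordered `x₁, …, x_ℓ` with
`N[x i] ⊆ N[x (i+1)]` for all `i`. -/
def IsSimpleVertex (G : SimpleGraph V) (x : V) : Prop :=
  ∃ l : List V, l.Nodup ∧ (∀ v, v ∈ l ↔ v ∈ closedNbhd G x) ∧
    l.Chain' fun a b => closedNbhd G a ⊆ closedNbhd G b

/-- If an enumeration `e` maximizes `∑ i, 2 ^ i * g (e i)`, then `g` is increasing along `e`. -/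
lemma monotone_of_sum_two_pow_mul_le {A : Type*} {n : ℕ} (g : A → ℕ) (e : Fin n ≃ A)
    (he : ∀ e' : Fin n ≃ A, ∑ i, 2 ^ i.val * g (e' i) ≤ ∑ i, 2 ^ i.val * g (e i)) :
    Monotone (g ∘ e) := by
  intro i j hij
  rcases hij.eq_or_lt with rfl | hij
  · exact le_rfl
  by_contra! hlt
  have h := he ((Equiv.swap i j).trans e)
  have hu : (2 : ℤ) ^ i.val < 2 ^ j.val := pow_lt_pow_right₀ (by norm_num) hij
  simp only [Function.comp] at hlt
  have hsum : ∑ t, ((2 : ℤ) ^ t.val * g (e (Equiv.swap i j t)) - 2 ^ t.val * g (e t)) =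
      (2 ^ i.val * g (e j) - 2 ^ i.val * g (e i)) +
        (2 ^ j.val * g (e i) - 2 ^ j.val * g (e j)) := by
    rw [Fintype.sum_eq_add i j hij.ne]
    · simp
    · rintro x ⟨hx, hx'⟩
      simp [Equiv.swap_apply_of_ne_of_ne hx hx']
  rw [Finset.sum_sub_distrib] at hsum
  simp only [Equiv.trans_apply] at h
  zify at h hlt
  nlinarith

/-- Comparison of binary expansions: if `P ≤ Q` as binary numbers and `P`, `Q` differ at `c` with
`P c` true, then the largest place where they differ is beyond `c`, and `Q` is true there. -/
lemma exists_top_difference {m : ℕ} {P Q : Fin m → Prop} [DecidablePred P] [DecidablePred Q]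
    (h : ∑ j : Fin m, 2 ^ j.val * (if P j then 1 else 0) ≤
      ∑ j : Fin m, 2 ^ j.val * (if Q j then 1 else 0))
    {c : Fin m} (hP : P c) (hQ : ¬ Q c) :
    ∃ c', c < c' ∧ Q c' ∧ ¬ P c' ∧ ∀ d, c' < d → (P d ↔ Q d) := by
  have key : ∀ (S : Fin m → Prop) [DecidablePred S],
      ∑ j : Fin m, 2 ^ j.val * (if S j then 1 else 0) =
        ∑ k ∈ (Finset.univ.filter S).map Fin.valEmbedding, 2 ^ k := by
    intro S _
    simp [Finset.sum_filter]
  rw [key P, key Q, Finset.geomSum_le_geomSum_iff_toColex_le_toColex le_rfl,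
    Finset.Colex.toColex_le_toColex_iff_max'_mem] at h
  set s := (Finset.univ.filter P).map Fin.valEmbedding with hs
  set t := (Finset.univ.filter Q).map Fin.valEmbedding with ht
  have hms : ∀ j : Fin m, j.val ∈ s ↔ P j := fun j => by
    simp [hs, Fin.val_inj]
  have hmt : ∀ j : Fin m, j.val ∈ t ↔ Q j := fun j => by
    simp [ht, Fin.val_inj]
  have hst : s ≠ t := fun hst => hQ ((hmt c).1 (hst ▸ (hms c).2 hP))
  have hmax := h hst
  have hmem := Finset.max'_mem _ (Finset.symmDiff_nonempty.2 hst)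
  set M := (symmDiff s t).max' (Finset.symmDiff_nonempty.2 hst) with hM
  have hle : ∀ x ∈ symmDiff s t, x ≤ M := fun x hx => Finset.le_max' _ x hx
  obtain ⟨c', hc', hc'M⟩ : ∃ c' : Fin m, Q c' ∧ c'.val = M := by
    simpa [ht] using hmax
  rw [← hc'M] at hmax hmem hle
  have hnot : ¬ P c' := by
    rw [Finset.mem_symmDiff, hms, hmt] at hmem
    tauto
  refine ⟨c', ?_, hc', hnot, fun d hd => ?_⟩
  · have h1 := hle c.val (by rw [Finset.mem_symmDiff, hms, hmt]; tauto)
    rcases (show c ≤ c' from h1).eq_or_lt with rfl | h2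
    · exact absurd hP hnot
    · exact h2
  · by_contra hne
    have h1 := hle d.val (by rw [Finset.mem_symmDiff, hms, hmt]; tauto)
    exact absurd hd (not_lt.2 h1)

/-- Every finite relation has a doubly lexical ordering. -/
lemma exists_doubly_lexical_order {A B : Type*} [Finite A] [Finite B] (R : A → B → Prop) :
    ∃ (n m : ℕ) (e : Fin n ≃ A) (f : Fin m ≃ B),
      (∀ a a' b, a < a' → R (e a) (f b) → ¬ R (e a') (f b) →
        ∃ b', b < b' ∧ R (e a') (f b') ∧ ¬ R (e a) (f b') ∧
          ∀ d, b' < d → (R (e a) (f d) ↔ R (e a') (f d))) ∧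
      (∀ b b' a, b < b' → R (e a) (f b) → ¬ R (e a) (f b') →
        ∃ a', a < a' ∧ R (e a') (f b') ∧ ¬ R (e a') (f b) ∧
          ∀ d, a' < d → (R (e d) (f b) ↔ R (e d) (f b'))) := by
  classical
  obtain ⟨n, ⟨e₀⟩⟩ := Finite.exists_equiv_fin A
  obtain ⟨m, ⟨f₀⟩⟩ := Finite.exists_equiv_fin B
  have : Nonempty ((Fin n ≃ A) × (Fin m ≃ B)) := ⟨(e₀.symm, f₀.symm)⟩
  obtain ⟨⟨e, f⟩, hmax⟩ := Finite.exists_max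
    (fun p : (Fin n ≃ A) × (Fin m ≃ B) =>
      ∑ i : Fin n, 2 ^ i.val * ∑ j : Fin m, 2 ^ j.val * (if R (p.1 i) (p.2 j) then 1 else 0))
  refine ⟨n, m, e, f, ?_, ?_⟩
  · intro a a' b hab h1 h2
    have hm := monotone_of_sum_two_pow_mul_le
      (fun x => ∑ j : Fin m, 2 ^ j.val * (if R x (f j) then 1 else 0)) e
      (fun e' => hmax (e', f)) hab.le
    exact exists_top_difference hm h1 h2
  · intro b b' a hab h1 h2
    have hcomm : ∀ f' : Fin m ≃ B,
        ∑ j : Fin m, 2 ^ j.val * ∑ i : Fin n, 2 ^ i.val * (if R (e i) (f' j) then 1 else 0) =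
        ∑ i : Fin n, 2 ^ i.val * ∑ j : Fin m, 2 ^ j.val * (if R (e i) (f' j) then 1 else 0) := by
      intro f'
      simp only [Finset.mul_sum]
      rw [Finset.sum_comm]
      simp only [mul_left_comm]
    have hm := monotone_of_sum_two_pow_mul_le
      (fun x => ∑ i : Fin n, 2 ^ i.val * (if R (e i) x then 1 else 0)) f
      (fun f' => by simpa only [hcomm] using hmax (e, f')) hab.le
    exact exists_top_difference (P := fun i => R (e i) (f b)) (Q := fun i => R (e i) (f b'))
      hm h1 h2

/-- A doubly lexically ordered relation without a chordless cycle of length at least three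
contains no `Γ` configuration. The `i`-th row and `i`-th column of the cycle alternate sides,
counted from the incidence of row `0` with column `0`. -/
lemma gamma_free_of_doubly_lexical {A B : Type*} [LinearOrder A] [LinearOrder B] [Finite A]
    (R : A → B → Prop)
    (hrow : ∀ a a' b, a < a' → R a b → ¬ R a' b →
      ∃ b', b < b' ∧ R a' b' ∧ ¬ R a b' ∧ ∀ d, b' < d → (R a d ↔ R a' d))
    (hcol : ∀ b b' a, b < b' → R a b → ¬ R a b' →
      ∃ a', a < a' ∧ R a' b' ∧ ¬ R a' b ∧ ∀ d, a' < d → (R d b ↔ R d b'))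
    (hcyc : ∀ m, 2 ≤ m → ∀ (r : ℕ → A) (c : ℕ → B), ¬ ∀ i j, i ≤ m → j ≤ m →
      (R (r i) (c j) ↔ (i = j + 1 ∨ j = i + 1 ∨ (i = 0 ∧ j = 0) ∨ (i = m ∧ j = m))))
    {a a' : A} {b b' : B} (ha : a < a') (hb : b < b') (h1 : R a b) (h2 : R a b')
    (h3 : R a' b) : R a' b' := by
  by_contra h4
  have main : ∀ x : A, ∀ (n : ℕ) (r : ℕ → A) (c : ℕ → B), r (n + 1) = x →
      r n < r (n + 1) → c n < c (n + 1) →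
      (∀ i j, i ≤ n + 1 → j ≤ n + 1 →
        (R (r i) (c j) ↔ (i = j + 1 ∨ j = i + 1 ∨ (i = 0 ∧ j = 0)))) →
      (∀ i ≤ n, ∀ d, c (n + 1) < d → (R (r i) d ↔ R (r n) d)) →
      (∀ i ≤ n, ∀ d, r (n + 1) < d → (R d (c i) ↔ R d (c n))) → False := by
    intro x
    induction x using (wellFounded_gt (α := A)).induction with
    | _ x ih =>
      intro n r c hx hr hc hpat hra hca
      obtain ⟨y, hy, hy1, hy2, hy3⟩ := hrow _ _ (c (n + 1)) hr
        ((hpat _ _ (by omega) (by omega)).2 (by omega))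
        (fun h => by have := (hpat _ _ (by omega) (by omega)).1 h; omega)
      obtain ⟨z, hz, hz1, hz2, hz3⟩ := hcol _ _ (r (n + 1)) hc
        ((hpat _ _ (by omega) (by omega)).2 (by omega))
        (fun h => by have := (hpat _ _ (by omega) (by omega)).1 h; omega)
      set r' : ℕ → A := fun i => if i ≤ n + 1 then r i else z with hr'
      set c' : ℕ → B := fun i => if i ≤ n + 1 then c i else y with hc'
      have er : ∀ i ≤ n + 1, r' i = r i := fun i hi => if_pos hi
      have ec : ∀ i ≤ n + 1, c' i = c i := fun i hi => if_pos hi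
      have erz : r' (n + 2) = z := if_neg (by omega)
      have ecy : c' (n + 2) = y := if_neg (by omega)
      have hpat' : ∀ i j, i ≤ n + 2 → j ≤ n + 2 → ¬ (i = n + 2 ∧ j = n + 2) →
          (R (r' i) (c' j) ↔ (i = j + 1 ∨ j = i + 1 ∨ (i = 0 ∧ j = 0))) := by
        intro i j hi hj hij
        rcases Nat.lt_or_ge (n + 1) i with hi' | hi'
        · obtain rfl : i = n + 2 := by omega
          rw [erz, ec j (by omega)]
          rcases Nat.lt_or_ge n j with hj' | hj'
          · obtain rfl : j = n + 1 := by omega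
            simp [hz1]
          · rw [hca j hj' z hz]
            exact iff_of_false hz2 (by omega)
        · rw [er i hi']
          rcases Nat.lt_or_ge (n + 1) j with hj' | hj'
          · obtain rfl : j = n + 2 := by omega
            rw [ecy]
            rcases Nat.lt_or_ge n i with hi'' | hi''
            · obtain rfl : i = n + 1 := by omega
              simp [hy1]
            · rw [hra i hi'' y hy]
              exact iff_of_false hy2 (by omega)
          · rw [ec j hj', hpat i j hi' hj']
      by_cases hzy : R z y
      · refine hcyc (n + 2) (by omega) r' c' fun i j hi hj => ?_
        by_cases hij : i = n + 2 ∧ j = n + 2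
        · rw [hij.1, hij.2, erz, ecy]
          exact iff_of_true hzy (by omega)
        · rw [hpat' i j hi hj hij]
          omega
      · refine ih z (hx ▸ hz) (n + 1) r' c' erz ?_ ?_ ?_ ?_ ?_
        · rwa [erz, er _ le_rfl]
        · rwa [ecy, ec _ le_rfl]
        · intro i j hi hj
          by_cases hij : i = n + 2 ∧ j = n + 2
          · rw [hij.1, hij.2, erz, ecy]
            exact iff_of_false hzy (by omega)
          · exact hpat' i j hi hj hij
        · intro i hi d hd
          rw [ecy] at hd
          rw [er i hi, er _ le_rfl]
          rcases Nat.lt_or_ge n i with hi' | hi'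
          · obtain rfl : i = n + 1 := by omega
            rfl
          · rw [hra i hi' d (hy.trans hd), hy3 d hd]
        · intro i hi d hd
          rw [erz] at hd
          rw [ec i hi, ec _ le_rfl]
          rcases Nat.lt_or_ge n i with hi' | hi'
          · obtain rfl : i = n + 1 := by omega
            rfl
          · rw [hca i hi' d (hz.trans hd), hz3 d hd]
  refine main a' 0 (fun i => if i = 0 then a else a') (fun i => if i = 0 then b else b')
    (by simp) (by simpa) (by simpa) ?_ ?_ ?_
  · intro i j hi hj
    interval_cases i <;> interval_cases j <;> simp [*]
  · intro i hi d _
    obtain rfl : i = 0 := by omega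
    rfl
  · intro i hi d _
    obtain rfl : i = 0 := by omega
    rfl

/-- A chordal graph has no chordless four-cycle. -/
lemma IsChordalGraph.not_fourCycle {G : SimpleGraph V} (hG : IsChordalGraph G) {a b c d : V}
    (hab : G.Adj a b) (hbc : G.Adj b c) (hcd : G.Adj c d) (hda : G.Adj d a)
    (hac : ¬ G.Adj a c) (hbd : ¬ G.Adj b d) (hac' : a ≠ c) (hbd' : b ≠ d) : False := by
  refine hG 4 le_rfl ⟨![a, b, c, d], ?_, ?_⟩
  · intro i j hij
    fin_cases i <;> fin_cases j <;>
      simp_all [hab.ne, hbc.ne, hcd.ne, hda.ne, hab.ne', hbc.ne', hcd.ne', hda.ne', hac'.symm,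
        hbd'.symm]
  · intro i j
    fin_cases i <;> fin_cases j <;>
      simp_all [hab.symm, hbc.symm, hcd.symm, hda.symm, G.adj_comm c a, G.adj_comm d b]

/-- In a chordal graph every edge of a cycle has a common neighbor on the cycle. -/
lemma IsChordalGraph.exists_common_neighbor {G : SimpleGraph V} (hG : IsChordalGraph G) (k : ℕ) :
    3 ≤ k → ∀ v : ℕ → V, (∀ i j, i < k → j < k → v i = v j → i = j) →
      (∀ i, i + 1 < k → G.Adj (v i) (v (i + 1))) → G.Adj (v 0) (v (k - 1)) →
      ∃ c, 0 < c ∧ c < k - 1 ∧ G.Adj (v 0) (v c) ∧ G.Adj (v c) (v (k - 1)) := by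
  induction k using Nat.strong_induction_on with
  | _ k ih =>
    intro hk v hinj hadj hclose
    rcases hk.eq_or_lt with rfl | hk
    · exact ⟨1, by omega, by omega, hadj 0 (by omega), hadj 1 (by omega)⟩
    obtain ⟨i, j, hij, hj, hchord, hnc⟩ : ∃ i j, i + 1 < j ∧ j < k ∧ G.Adj (v i) (v j) ∧
        ¬ (i = 0 ∧ j = k - 1) := by
      by_contra! hno
      have hlt : ∀ i j : ℕ, i < j → j < k →
          (G.Adj (v i) (v j) ↔ (i + 1 = j ∨ (i = 0 ∧ j = k - 1))) := by
        intro i j hij hj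
        constructor
        · intro h
          rcases Nat.lt_or_ge (i + 1) j with h' | h'
          · by_contra hc
            have h2 := hno i j h' hj h
            omega
          · omega
        · rintro (rfl | ⟨rfl, rfl⟩)
          · exact hadj i hj
          · exact hclose
      have hmod : ∀ i j : ℕ, i < k → j < k →
          ((i + 1) % k = j ↔ (i + 1 = j ∨ (j = 0 ∧ i = k - 1))) := by
        intro i j hi hj
        rcases Nat.lt_or_ge (i + 1) k with h | h
        · rw [Nat.mod_eq_of_lt h]; omega
        · obtain rfl : k = i + 1 := by omega
          rw [Nat.mod_self]; omega
      refine hG k hk ⟨fun i => v i, fun i j h => Fin.ext (hinj _ _ i.2 j.2 h), fun i j => ?_⟩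
      rw [hmod i j i.2 j.2, hmod j i j.2 i.2]
      rcases lt_trichotomy i.val j.val with h | h | h
      · rw [hlt _ _ h j.2]; omega
      · obtain rfl : i = j := Fin.ext h
        exact iff_of_false G.irrefl (by omega)
      · rw [G.adj_comm, hlt _ _ h i.2]; omega
    have e1 : ∀ t ≤ i, (if t ≤ i then v t else v (t + (j - i - 1))) = v t := fun t ht => if_pos ht
    have e2 : ∀ t, i < t → (if t ≤ i then v t else v (t + (j - i - 1))) = v (t + (j - i - 1)) :=
      fun t ht => if_neg (by omega)
    obtain ⟨c, hc0, hc1, hc2, hc3⟩ := ih (k - (j - i - 1)) (by omega) (by omega)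
      (fun t => if t ≤ i then v t else v (t + (j - i - 1))) (by
        intro s t hs ht hst
        rcases Nat.lt_or_ge i s with h | h <;> rcases Nat.lt_or_ge i t with h' | h'
        · rw [e2 s h, e2 t h'] at hst
          have := hinj _ _ (by omega) (by omega) hst
          omega
        · rw [e2 s h, e1 t h'] at hst
          have := hinj _ _ (by omega) (by omega) hst
          omega
        · rw [e1 s h, e2 t h'] at hst
          have := hinj _ _ (by omega) (by omega) hst
          omega
        · rw [e1 s h, e1 t h'] at hst
          exact hinj _ _ (by omega) (by omega) hst) (by
        intro t ht
        rcases lt_trichotomy t i with h | h | h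
        · rw [e1 t h.le, e1 _ h]
          exact hadj t (by omega)
        · subst h
          rw [e1 t le_rfl, e2 _ (by omega), show t + 1 + (j - t - 1) = j by omega]
          exact hchord
        · rw [e2 t h, e2 _ (by omega), show t + 1 + (j - i - 1) = t + (j - i - 1) + 1 by omega]
          exact hadj _ (by omega)) (by
        rw [e1 0 (by omega)]
        rcases Nat.lt_or_ge i (k - (j - i - 1) - 1) with h | h
        · rw [e2 _ h, show k - (j - i - 1) - 1 + (j - i - 1) = k - 1 by omega]
          exact hclose
        · omega)
    rw [e1 0 (by omega)] at hc2
    rw [e2 (k - (j - i - 1) - 1) (by omega),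
      show k - (j - i - 1) - 1 + (j - i - 1) = k - 1 by omega] at hc3
    rcases Nat.lt_or_ge i c with h | h
    · rw [e2 c h] at hc2 hc3
      exact ⟨_, by omega, by omega, hc2, hc3⟩
    · rw [e1 c h] at hc2 hc3
      exact ⟨c, by omega, by omega, hc2, hc3⟩

/-- Every clique of a finite graph extends to a maximal one. -/
lemma exists_maximal_isClique_superset [Finite V] (G : SimpleGraph V) {s : Set V}
    (hs : G.IsClique s) : ∃ K, s ⊆ K ∧ Maximal G.IsClique K :=
  Finite.exists_le_maximal hs

/-- A special cycle of length `k` in the maximal clique hypergraph: the `i`-th clique contains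
exactly the `i`-th and the cyclically next one among the vertices `v 0, …, v (k - 1)`. -/
def IsSpecialCliqueCycle (G : SimpleGraph V) (k : ℕ) (v : ℕ → V) (K : ℕ → Set V) : Prop :=
  (∀ i < k, Maximal G.IsClique (K i)) ∧
    ∀ i j, i < k → j < k → (v j ∈ K i ↔ (j = i ∨ j = i + 1 ∨ (i = k - 1 ∧ j = 0)))

lemma IsSpecialCliqueCycle.injective {G : SimpleGraph V} {k : ℕ} {v : ℕ → V} {K : ℕ → Set V}
    (h : IsSpecialCliqueCycle G k v K) (hk : 3 ≤ k) :
    ∀ i j, i < k → j < k → v i = v j → i = j := by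
  intro i j hi hj hij
  have h1 := h.2 i i hi hi
  have h2 := h.2 i j hi hj
  have h3 := h.2 j i hj hi
  have h4 := h.2 j j hj hj
  rw [hij] at h1 h3
  have h5 := h1.symm.trans h2
  have h6 := h3.symm.trans h4
  omega

lemma IsSpecialCliqueCycle.adj {G : SimpleGraph V} {k : ℕ} {v : ℕ → V} {K : ℕ → Set V}
    (h : IsSpecialCliqueCycle G k v K) (hk : 3 ≤ k) {i : ℕ} (hi : i + 1 < k) :
    G.Adj (v i) (v (i + 1)) := by
  refine (h.1 i (by omega)).prop ((h.2 i i (by omega) (by omega)).2 (by omega))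
    ((h.2 i (i + 1) (by omega) hi).2 (by omega)) fun he => ?_
  have := h.injective hk _ _ (by omega) hi he
  omega

/-- In a special cycle of minimal length, a maximal clique meets the cycle in an interval,
unless it meets it exactly in the two ends. -/
lemma IsSpecialCliqueCycle.mem_of_mem_of_mem {G : SimpleGraph V} {k : ℕ} {v : ℕ → V}
    {K : ℕ → Set V} (h : IsSpecialCliqueCycle G k v K)
    (hmin : ∀ k', 3 ≤ k' → k' < k → ∀ v' K', ¬ IsSpecialCliqueCycle G k' v' K')
    {L : Set V} (hL : Maximal G.IsClique L) (n : ℕ) :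
    ∀ a b, b = a + n → b < k → n < k - 1 → v a ∈ L → v b ∈ L →
      ∀ c, a ≤ c → c ≤ b → v c ∈ L := by
  induction n using Nat.strong_induction_on with
  | _ n ih =>
    intro a b hab hb hn ha hbL c hac hcb
    by_cases hex : ∃ d, a < d ∧ d < b ∧ v d ∈ L
    · obtain ⟨d, had, hdb, hd⟩ := hex
      rcases le_total c d with hcd | hcd
      · exact ih (d - a) (by omega) a d (by omega) (by omega) (by omega) ha hd c hac hcd
      · exact ih (b - d) (by omega) d b (by omega) (by omega) (by omega) hd hbL c hcd hcb
    · push Not at hex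
      by_contra hc
      have hca : c ≠ a := fun e => hc (e ▸ ha)
      have hcb' : c ≠ b := fun e => hc (e ▸ hbL)
      refine hmin (n + 1) (by omega) (by omega) (fun i => v (a + i))
        (fun i => if i < n then K (a + i) else L) ⟨fun i hi => ?_, fun i j hi hj => ?_⟩
      · dsimp only
        split_ifs
        · exact h.1 _ (by omega)
        · exact hL
      · dsimp only
        split_ifs with hin
        · rw [h.2 _ _ (by omega) (by omega)]
          omega
        · obtain rfl : i = n := by omega
          constructor
          · intro hjL
            by_contra hne
            exact hex (a + j) (by omega) (by omega) hjL
          · rintro (rfl | rfl | ⟨-, rfl⟩)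
            · rwa [← hab]
            · omega
            · exact ha

/-- In a chordal graph, a nonempty maximal clique `K` disjoint from a clique `D` has a vertex
adjacent to no vertex of `D`. -/
lemma IsChordalGraph.exists_mem_forall_not_adj [Finite V] {G : SimpleGraph V}
    (hG : IsChordalGraph G) {K D : Set V} (hK : Maximal G.IsClique K) (hne : K.Nonempty)
    (hD : G.IsClique D) (hKD : Disjoint K D) : ∃ x ∈ K, ∀ d ∈ D, ¬ G.Adj x d := by
  obtain ⟨x, hx, hmin⟩ := Set.exists_min_image K (fun x => {d ∈ D | G.Adj x d}.ncard)
    (Set.toFinite K) hne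
  refine ⟨x, hx, fun d hd hxd => ?_⟩
  have hdK : d ∉ K := fun h => hKD.le_bot ⟨h, hd⟩
  obtain ⟨y, hy, hyd⟩ : ∃ y ∈ K, ¬ G.Adj y d := by
    by_contra! hall
    refine hdK (hK.le_of_ge (y := insert d K) ?_ (Set.subset_insert _ _) (Set.mem_insert _ _))
    rw [SimpleGraph.isClique_insert]
    exact ⟨hK.prop, fun b hb _ => (hall b hb).symm⟩
  obtain ⟨e, ⟨he, hye⟩, hxe⟩ : ∃ e, e ∈ {e ∈ D | G.Adj y e} ∧ e ∉ {e ∈ D | G.Adj x e} := by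
    by_contra! hsub
    refine (hmin y hy).not_gt (Set.ncard_lt_ncard ⟨hsub, fun h => hyd (h ⟨hd, hxd⟩).2⟩ ?_)
    exact Set.toFinite _
  have hxe' : ¬ G.Adj x e := fun h => hxe ⟨he, h⟩
  have hxy : x ≠ y := fun h => hyd (h ▸ hxd)
  have hde : d ≠ e := fun h => hxe' (h ▸ hxd)
  exact hG.not_fourCycle (hK.prop hx hy hxy) hye (hD he hd hde.symm) hxd.symm hxe' hyd
    (fun h => hKD.le_bot ⟨hx, h ▸ he⟩) (fun h => hdK (h ▸ hy))

/-- The maximal clique hypergraph of a strongly chordal graph has no special cycle. -/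
lemma StronglyChordal.not_isSpecialCliqueCycle [Finite V] {G : SimpleGraph V}
    (hG : StronglyChordal G) {k : ℕ} (hk : 3 ≤ k) (v : ℕ → V) (K : ℕ → Set V) :
    ¬ IsSpecialCliqueCycle G k v K := by
  induction k using Nat.strong_induction_on generalizing v K with
  | _ k ih =>
    intro h
    have hinj := h.injective hk
    have hclose : G.Adj (v 0) (v (k - 1)) := by
      refine (h.1 (k - 1) (by omega)).prop ((h.2 _ _ (by omega) (by omega)).2 (by omega))
        ((h.2 _ _ (by omega) (by omega)).2 (by omega)) fun he => ?_
      have := hinj _ _ (by omega) (by omega) he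
      omega
    obtain ⟨c, hc0, hc1, hc2, hc3⟩ := hG.1.exists_common_neighbor k hk v hinj
      (fun i hi => h.adj hk hi) hclose
    obtain ⟨L, hcL, hL⟩ := exists_maximal_isClique_superset G (s := {v 0, v c, v (k - 1)}) (by
      simp only [SimpleGraph.isClique_insert, SimpleGraph.isClique_singleton]
      simp [hc2, hc3, hclose])
    have hmem := h.mem_of_mem_of_mem (fun k' h3 hlt v' K' => ih k' hlt h3 v' K') hL
    have hall : ∀ i < k, v i ∈ L := by
      intro i hi
      rcases le_total i c with hic | hic
      · exact hmem c 0 c (by omega) (by omega) (by omega) (hcL (by simp)) (hcL (by simp)) i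
          (by omega) hic
      · exact hmem (k - 1 - c) c (k - 1) (by omega) (by omega) (by omega) (hcL (by simp))
          (hcL (by simp)) i hic (by omega)
    have hadj : ∀ i j, i < k → j < k → i ≠ j → G.Adj (v i) (v j) := fun i j hi hj hij =>
      hL.prop (hall i hi) (hall j hj) fun he => hij (hinj i j hi hj he)
    have hs : ∀ i : Fin k, ∃ x ∈ K i, ∀ j < k, v j ∉ K i → ¬ G.Adj x (v j) := by
      intro i
      obtain ⟨x, hx, hxd⟩ := hG.1.exists_mem_forall_not_adj (h.1 i i.2)
        ⟨v i, (h.2 i i i.2 i.2).2 (by omega)⟩ (D := {y | y ∉ K i ∧ ∃ j < k, v j = y})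
        (by
          rintro _ ⟨-, j, hj, rfl⟩ _ ⟨-, l, hl, rfl⟩ hne
          exact hadj j l hj hl fun e => hne (e ▸ rfl))
        (Set.disjoint_left.2 fun x hx hx' => hx'.1 hx)
      exact ⟨x, hx, fun j hj hjK => hxd _ ⟨hjK, j, hj, rfl⟩⟩
    choose s hsK hs using hs
    have hsne : ∀ i : Fin k, ∀ j < k, v j ≠ s i := by
      intro i j hj hij
      obtain ⟨l, hl, hlK⟩ : ∃ l < k, v l ∉ K i := by
        by_contra! hcon
        have i2 := i.2
        have h0 := (h.2 i 0 i.2 (by omega)).1 (hcon 0 (by omega))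
        have h1 := (h.2 i 1 i.2 (by omega)).1 (hcon 1 (by omega))
        have h2 := (h.2 i 2 i.2 (by omega)).1 (hcon 2 (by omega))
        omega
      refine hs i l hl hlK (hij ▸ hadj j l hj hl ?_)
      rintro rfl
      exact hlK (hij ▸ hsK i)
    have hsadj : ∀ i : Fin k, ∀ j < k, (G.Adj (s i) (v j) ↔ v j ∈ K i) := fun i j hj =>
      ⟨fun ha => by_contra fun hn => hs i j hj hn ha,
        fun hm => (h.1 i i.2).prop (hsK i) hm (hsne i j hj).symm⟩
    have hsep : ∀ i j : Fin k, i ≠ j → ∃ p < k, v p ∈ K i ∧ v p ∉ K j := by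
      intro i j hij
      by_contra! hcon
      have hij' : i.val ≠ j.val := fun e => hij (Fin.ext e)
      have i2 := i.2
      have j2 := j.2
      have e : ∀ p < k, (p = i.val ∨ p = i + 1 ∨ (i.val = k - 1 ∧ p = 0)) →
          (p = j.val ∨ p = j + 1 ∨ (j.val = k - 1 ∧ p = 0)) := fun p hp hpi =>
        (h.2 j p j.2 hp).1 (hcon p hp ((h.2 i p i.2 hp).2 hpi))
      have h1 := e i i.2 (by omega)
      rcases Nat.lt_or_ge (i.val + 1) k with hlt | hge
      · have h2 := e (i + 1) hlt (by omega)
        omega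
      · have h2 := e 0 (by omega) (by omega)
        omega
    refine hG.2 k hk ⟨fun i => v i, s, fun i j hij => Fin.ext (hinj _ _ i.2 j.2 hij), ?_,
      fun i j => hsne j i i.2, fun i j hij => hadj _ _ i.2 j.2 fun e => hij (Fin.ext e), ?_, ?_⟩
    · intro i j hij
      by_contra hne
      obtain ⟨p, hp, hpi, hpj⟩ := hsep i j hne
      exact hpj ((hsadj j p hp).1 (hij ▸ (hsadj i p hp).2 hpi))
    · intro i j
      have i2 := i.2
      have j2 := j.2
      rw [hsadj i j j.2, h.2 i j i.2 j.2]
      rcases Nat.lt_or_ge (i.val + 1) k with hlt | hge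
      · rw [Nat.mod_eq_of_lt hlt]
        omega
      · rw [show i.val + 1 = k by omega, Nat.mod_self]
        omega
    · intro i j hij
      have hne : i ≠ j := fun e => G.irrefl (e ▸ hij)
      obtain ⟨p, hp, hpi, hpj⟩ := hsep i j hne
      obtain ⟨q, hq, hqj, hqi⟩ := hsep j i hne.symm
      have hpq : p ≠ q := fun e => hpj (e ▸ hqj)
      exact hG.1.not_fourCycle ((hsadj i p hp).2 hpi) (hadj p q hp hq hpq)
        ((hsadj j q hq).2 hqj).symm hij.symm (fun ha => hqi ((hsadj i q hq).1 ha))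
        (fun ha => hpj ((hsadj j p hp).1 ha.symm)) (hsne i q hq).symm (hsne j p hp)

/-- A chordless cycle of the incidence relation between vertices and maximal cliques, with rows and
columns enumerated alternately on both sides, can be unfolded to a special cycle. -/
lemma exists_isSpecialCliqueCycle_of_folded {G : SimpleGraph V} {m : ℕ} (hm : 2 ≤ m) (r : ℕ → V)
    (c : ℕ → Set V) (hc : ∀ j ≤ m, Maximal G.IsClique (c j))
    (hpat : ∀ i j, i ≤ m → j ≤ m →
      (r i ∈ c j ↔ (i = j + 1 ∨ j = i + 1 ∨ (i = 0 ∧ j = 0) ∨ (i = m ∧ j = m)))) :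
    ∃ v K, IsSpecialCliqueCycle G (m + 1) v K := by
  obtain ⟨h, hh⟩ : ∃ h, m + 1 = 2 * h ∨ m + 1 = 2 * h + 1 := ⟨(m + 1) / 2, by omega⟩
  refine ⟨fun i => r (if h ≤ i then 2 * (i - h) else 2 * (h - i) - 1),
    fun i => c (if i = m then m else if h ≤ i then 2 * (i - h) + 1 else 2 * (h - i) - 2),
    fun i hi => ?_, fun i j hi hj => ?_⟩
  · refine hc _ ?_
    split_ifs <;> omega
  · dsimp only
    rw [hpat _ _ (by split_ifs <;> omega) (by split_ifs <;> omega)]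
    rcases hh with hh | hh <;> split_ifs <;>
      (try simp only [and_false, false_or, and_true]) <;> omega

/-- Every nonempty finite strongly chordal graph has a simple vertex. -/
lemma StronglyChordal.exists_isSimpleVertex [Finite V] [Nonempty V] {G : SimpleGraph V}
    (hG : StronglyChordal G) : ∃ x, IsSimpleVertex G x := by
  classical
  obtain ⟨n, m, e, f, hrow, hcol⟩ := exists_doubly_lexical_order
    (fun (x : V) (K : {K : Set V // Maximal G.IsClique K}) => x ∈ K.1)
  have hΓ : ∀ {a a' : Fin n} {b b' : Fin m}, a < a' → b < b' → e a ∈ (f b).1 → e a ∈ (f b').1 →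
      e a' ∈ (f b).1 → e a' ∈ (f b').1 :=
    gamma_free_of_doubly_lexical (fun a b => e a ∈ (f b).1) hrow hcol fun m hm r c hpat => by
      obtain ⟨v, K, hvK⟩ := exists_isSpecialCliqueCycle_of_folded hm (fun i => e (r i))
        (fun j => (f (c j)).1) (fun j _ => (f (c j)).2) hpat
      exact hG.not_isSpecialCliqueCycle (by omega) v K hvK
  have hcover : ∀ s : Set V, G.IsClique s → ∃ b, s ⊆ (f b).1 := fun s hs => by
    obtain ⟨K, hsK, hK⟩ := exists_maximal_isClique_superset G hs
    exact ⟨f.symm ⟨K, hK⟩, by simpa⟩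
  have hpair : ∀ x y, G.Adj x y → ∃ b, x ∈ (f b).1 ∧ y ∈ (f b).1 := fun x y hxy => by
    obtain ⟨b, hb⟩ := hcover {x, y} (by simp [SimpleGraph.isClique_insert, hxy])
    exact ⟨b, hb (by simp), hb (by simp)⟩
  obtain ⟨x₀⟩ := ‹Nonempty V›
  obtain ⟨b₁, hb₁⟩ := hcover {x₀} (by simp)
  have hm : 0 < m := b₁.pos
  set b₀ : Fin m := ⟨0, hm⟩ with hb₀
  have hmem : ∀ {a a' : Fin n} {b : Fin m}, a ≤ a' → e a ∈ (f b₀).1 → e a' ∈ (f b₀).1 →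
      e a ∈ (f b).1 → e a' ∈ (f b).1 := by
    intro a a' b haa h1 h2 h3
    rcases haa.eq_or_lt with rfl | haa
    · exact h3
    rcases eq_or_ne b b₀ with rfl | hb
    · exact h2
    exact hΓ haa (lt_of_le_of_ne (Nat.zero_le b.val) hb.symm) h1 h3 h2
  have hne : ((f b₀).1).Nonempty := by
    by_contra hemp
    rw [Set.not_nonempty_iff_eq_empty] at hemp
    have := (f b₀).2.le_of_ge (y := {x₀}) (by simp) (by simp [hemp])
    simp [hemp] at this
  obtain ⟨a, ha, hmin⟩ := Set.exists_min_image {a | e a ∈ (f b₀).1} id (Set.toFinite _)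
    (by obtain ⟨y, hy⟩ := hne; exact ⟨e.symm y, by simpa⟩)
  have hN : ∀ y, y ∈ closedNbhd G (e a) ↔ y ∈ (f b₀).1 := by
    intro y
    constructor
    · rintro (rfl | hy)
      · exact ha
      obtain ⟨b, hab, hyb⟩ := hpair _ _ hy
      refine (f b₀).2.le_of_ge (f b).2.prop (fun z hz => ?_) hyb
      have := hmem (b := b) (hmin (e.symm z) (by simpa)) ha (by simpa) hab
      simpa using this
    · intro hy
      rcases eq_or_ne y (e a) with rfl | hne'
      · exact Set.mem_insert _ _
      · exact Set.mem_insert_of_mem _ ((f b₀).2.prop ha hy hne'.symm)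
  have hsub : ∀ i j, i ≤ j → e i ∈ (f b₀).1 → e j ∈ (f b₀).1 →
      closedNbhd G (e i) ⊆ closedNbhd G (e j) := by
    rintro i j hij hi hj y (rfl | hy)
    · rcases eq_or_ne (e i) (e j) with h | h
      · exact h ▸ Set.mem_insert _ _
      · exact Set.mem_insert_of_mem _ ((f b₀).2.prop hj hi h.symm)
    · obtain ⟨b, hib, hyb⟩ := hpair _ _ hy
      rcases eq_or_ne y (e j) with rfl | h
      · exact Set.mem_insert _ _
      · exact Set.mem_insert_of_mem _ ((f b).2.prop (hmem hij hi hj hib) hyb h.symm)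
  set F : Finset (Fin n) := Finset.univ.filter fun i => e i ∈ (f b₀).1 with hF
  refine ⟨e a, (F.sort (· ≤ ·)).map e, (Finset.sort_nodup _ _).map e.injective, fun y => ?_, ?_⟩
  · rw [hN]
    simp only [List.mem_map, Finset.mem_sort, hF, Finset.mem_filter, Finset.mem_univ, true_and]
    exact ⟨fun ⟨i, hi, hiy⟩ => hiy ▸ hi, fun hy => ⟨e.symm y, by simpa, by simp⟩⟩
  · refine List.Pairwise.isChain (List.pairwise_map.2 ?_)
    refine (Finset.pairwise_sort F (· ≤ ·)).imp_of_mem fun {i j} hi hj hij => hsub i j hij ?_ ?_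
    · simpa [hF] using hi
    · simpa [hF] using hj

/-- The property of being strongly chordal passes to induced subgraphs. -/
lemma StronglyChordal.induce {G : SimpleGraph V} (hG : StronglyChordal G) (W : Set V) :
    StronglyChordal (G.induce W) := by
  refine ⟨fun n hn => ?_, fun k hk => ?_⟩
  · rintro ⟨f, hf, hadj⟩
    exact hG.1 n hn ⟨fun i => f i, Subtype.val_injective.comp hf, hadj⟩
  · rintro ⟨c, s, hc, hs, hcs, h1, h2, h3⟩
    exact hG.2 k hk ⟨fun i => c i, fun i => s i, Subtype.val_injective.comp hc,
      Subtype.val_injective.comp hs, fun i j h => hcs i j (Subtype.ext h), h1, h2, h3⟩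

/-- Two neighbors of a simple vertex cannot have private neighbors with respect to each other. -/
lemma IsSimpleVertex.false_of_incomparable {G : SimpleGraph V} {W : Set V} {x : W}
    (hx : IsSimpleVertex (G.induce W) x) {a b p q : V} (ha : a ∈ W) (hb : b ∈ W) (hp : p ∈ W)
    (hq : q ∈ W) (hxa : G.Adj x a) (hxb : G.Adj x b) (hpa : p = a ∨ G.Adj a p)
    (hpb : p ≠ b ∧ ¬ G.Adj b p) (hqb : q = b ∨ G.Adj b q) (hqa : q ≠ a ∧ ¬ G.Adj a q) : False := by
  obtain ⟨l, -, hl, hchain⟩ := hx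
  have : IsTrans W fun a b => closedNbhd (G.induce W) a ⊆ closedNbhd (G.induce W) b :=
    ⟨fun _ _ _ h h' => h.trans h'⟩
  have hpw := List.isChain_iff_pairwise.1 hchain
  have hcomp : ∀ y ∈ l, ∀ z ∈ l, closedNbhd (G.induce W) y ⊆ closedNbhd (G.induce W) z ∨
      closedNbhd (G.induce W) z ⊆ closedNbhd (G.induce W) y := by
    intro y hy z hz
    obtain ⟨i, hi, rfl⟩ := List.mem_iff_getElem.1 hy
    obtain ⟨j, hj, rfl⟩ := List.mem_iff_getElem.1 hz
    rw [List.pairwise_iff_getElem] at hpw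
    rcases lt_trichotomy i j with h | h | h
    · exact Or.inl (hpw i j hi hj h)
    · subst h; exact Or.inl subset_rfl
    · exact Or.inr (hpw j i hj hi h)
  have hmem : ∀ y z : W, y ∈ closedNbhd (G.induce W) z ↔ y.1 = z.1 ∨ G.Adj z y := fun y z => by
    simp [closedNbhd, Subtype.ext_iff]
  rcases hcomp ⟨a, ha⟩ ((hl _).2 ((hmem _ _).2 (Or.inr hxa))) ⟨b, hb⟩
    ((hl _).2 ((hmem _ _).2 (Or.inr hxb))) with h | h
  · rcases (hmem _ _).1 (h ((hmem ⟨p, hp⟩ _).2 hpa)) with h' | h'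
    · exact hpb.1 h'
    · exact hpb.2 h'
  · rcases (hmem _ _).1 (h ((hmem ⟨q, hq⟩ _).2 hqb)) with h' | h'
    · exact hqa.1 h'
    · exact hqa.2 h'

/-- The cyclic successor and predecessor of an index, with the facts `omega` needs about them. -/
lemma exists_cyclic_neighbors {k : ℕ} (i : Fin k) : ∃ p q : Fin k,
    (i.val + 1) % k = p.val ∧ (q.val + 1) % k = i.val ∧
      (p.val = i + 1 ∨ (i.val = k - 1 ∧ p.val = 0)) ∧
      (i.val = q + 1 ∨ (q.val = k - 1 ∧ i.val = 0)) := by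
  have i2 := i.2
  have h : ∀ t < k, (t + 1 < k ∧ (t + 1) % k = t + 1) ∨ (t = k - 1 ∧ (t + 1) % k = 0) := by
    intro t ht
    rcases Nat.lt_or_ge (t + 1) k with h | h
    · exact Or.inl ⟨h, Nat.mod_eq_of_lt h⟩
    · right
      obtain rfl : k = t + 1 := by omega
      simp
  have hi := h i i2
  rcases Nat.eq_zero_or_pos i.val with h0 | h0
  · have hq := h (k - 1) (by omega)
    exact ⟨⟨(i + 1) % k, Nat.mod_lt _ (by omega)⟩, ⟨k - 1, by omega⟩, rfl, by dsimp only; omega,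
      by dsimp only; omega, by dsimp only; omega⟩
  · have hq := h (i - 1) (by omega)
    exact ⟨⟨(i + 1) % k, Nat.mod_lt _ (by omega)⟩, ⟨i - 1, by omega⟩, rfl, by dsimp only; omega,
      by dsimp only; omega, by dsimp only; omega⟩

lemma isChordalGraph_of_simple_vertex {G : SimpleGraph V}
    (h : ∀ W : Set V, W.Nonempty → ∃ x : W, IsSimpleVertex (G.induce W) x) :
    IsChordalGraph G := by
  rintro n hn ⟨f, hf, hadj⟩
  obtain ⟨⟨_, i, rfl⟩, hx⟩ := h (Set.range f) ⟨f ⟨0, by omega⟩, Set.mem_range_self _⟩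
  obtain ⟨p, q, hp, hq, hp', hq'⟩ := exists_cyclic_neighbors i
  have hpq : ¬ G.Adj (f p) (f q) := by
    obtain ⟨p₂, p₁, hp₂, hp₁, hp₂', hp₁'⟩ := exists_cyclic_neighbors p
    obtain ⟨q₂, q₁, hq₂, hq₁, hq₂', hq₁'⟩ := exists_cyclic_neighbors q
    rw [hadj]
    omega
  have hne : p ≠ q := fun e => by
    have := congrArg Fin.val e
    omega
  exact hx.false_of_incomparable (Set.mem_range_self p) (Set.mem_range_self q)
    (Set.mem_range_self p) (Set.mem_range_self q) ((hadj _ _).2 (Or.inl hp))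
    ((hadj _ _).2 (Or.inr hq)) (Or.inl rfl) ⟨fun e => hne (hf e), fun ha => hpq ha.symm⟩
    (Or.inl rfl) ⟨fun e => hne (hf e).symm, hpq⟩

lemma not_hasInducedSun_of_simple_vertex {G : SimpleGraph V}
    (h : ∀ W : Set V, W.Nonempty → ∃ x : W, IsSimpleVertex (G.induce W) x) {k : ℕ} (hk : 3 ≤ k) :
    ¬ HasInducedSun G k := by
  rintro ⟨c, s, hc, hs, hcs, hcc, hsc, hss⟩
  have hcW : ∀ i, c i ∈ Set.range c ∪ Set.range s := fun i => Or.inl (Set.mem_range_self i)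
  have hsW : ∀ i, s i ∈ Set.range c ∪ Set.range s := fun i => Or.inr (Set.mem_range_self i)
  obtain ⟨⟨_, ⟨i, rfl⟩ | ⟨i, rfl⟩⟩, hx⟩ := h (Set.range c ∪ Set.range s) ⟨_, hcW ⟨0, by omega⟩⟩
  all_goals
    obtain ⟨p, q, hp, hq, hp', hq'⟩ := exists_cyclic_neighbors i
    obtain ⟨p₂, p₁, hp₂, hp₁, hp₂', hp₁'⟩ := exists_cyclic_neighbors p
    obtain ⟨q₂, q₁, hq₂, hq₁, hq₂', hq₁'⟩ := exists_cyclic_neighbors q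
    have i2 := i.2
  · have hne : i ≠ q := fun e => by
      have := congrArg Fin.val e
      omega
    exact hx.false_of_incomparable (hsW i) (hsW q) (hsW i) (hsW q)
      ((hsc i i).2 (Or.inl rfl)).symm ((hsc q i).2 (by omega)).symm
      (Or.inl rfl) ⟨fun e => hne (hs e), hss _ _⟩ (Or.inl rfl) ⟨fun e => hne (hs e).symm, hss _ _⟩
  · exact hx.false_of_incomparable (hcW i) (hcW p) (hsW q) (hsW p)
      ((hsc i i).2 (Or.inl rfl)) ((hsc i p).2 (by omega))
      (Or.inr ((hsc q i).2 (by omega)).symm)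
      ⟨(hcs _ _).symm, fun ha => by have := (hsc q p).1 ha.symm; omega⟩
      (Or.inr ((hsc p p).2 (Or.inl rfl)).symm)
      ⟨(hcs _ _).symm, fun ha => by have := (hsc p i).1 ha.symm; omega⟩

/-- A finite graph is strongly chordal iff every nonempty induced subgraph has a simple
vertex. -/
theorem stronglyChordal_iff_simple_vertex [Fintype V] (G : SimpleGraph V) :
    StronglyChordal G ↔
      ∀ W : Set V, W.Nonempty → ∃ x : W, IsSimpleVertex (G.induce W) x := by
  refine ⟨fun hG W hW => ?_, fun h =>
    ⟨isChordalGraph_of_simple_vertex h, fun k hk => not_hasInducedSun_of_simple_vertex h hk⟩⟩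
  have := hW.to_subtype
  exact (hG.induce W).exists_isSimpleVertex
end

section
/- Let G = (A,B,E) be a chordal bipartite graph with B ≠ ∅. Then B contains a vertex that is simple in the graph G_A obtained from G by adding an edge between every pair of distinct vertices of A. -/
variable {V : Type*}

/-- The spanning subgraph of `G` keeping only the edges with both ends in `W`. -/
def restrictEdges (G : SimpleGraph V) (W : Set V) : SimpleGraph V where
  Adj u v := G.Adj u v ∧ u ∈ W ∧ v ∈ W
  symm := ⟨fun _ _ h => ⟨h.1.symm, h.2.2, h.2.1⟩⟩
  loopless := ⟨fun _ h => G.loopless.irrefl _ h.1⟩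

/-- The `i`-th vertex of a shortest walk is at distance `i` from its start. -/
lemma dist_getVert_of_length_eq_dist {K : SimpleGraph V} {p q : V} (w : K.Walk p q)
    (hw : w.length = K.dist p q) {i : ℕ} (hi : i ≤ w.length) : K.dist p (w.getVert i) = i := by
  have h1 : K.dist p (w.getVert i) ≤ i :=
    (SimpleGraph.dist_le (w.take i)).trans (by simp)
  have h2 : K.dist (w.getVert i) q ≤ w.length - i :=
    (SimpleGraph.dist_le (w.drop i)).trans (by simp)
  have h3 : K.dist p q ≤ K.dist p (w.getVert i) + K.dist (w.getVert i) q := by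
    obtain ⟨u, hu⟩ := (w.take i).reachable.exists_walk_length_eq_dist
    obtain ⟨v, hv⟩ := (w.drop i).reachable.exists_walk_length_eq_dist
    rw [← hu, ← hv, ← SimpleGraph.Walk.length_append]
    exact SimpleGraph.dist_le _
  omega

/-- Two nonadjacent neighbors of `e` joined by a path with interior in `D`, where `D` contains
neither `e` nor neighbors of `e`, have a common neighbor in `D`. -/
lemma ChordalBipartite.exists_common_neighbor {G : SimpleGraph V} (hG : ChordalBipartite G)
    {D : Set V} {e p q : V} (hpq : ¬ G.Adj p q) (hne : p ≠ q) (hp : G.Adj e p) (hq : G.Adj e q)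
    (heD : e ∉ D) (hD : ∀ v ∈ D, ¬ G.Adj e v)
    (hr : (restrictEdges G (D ∪ {p, q})).Reachable p q) :
    ∃ a ∈ D, G.Adj a p ∧ G.Adj a q := by
  set K := restrictEdges G (D ∪ {p, q})
  obtain ⟨w, hw⟩ := hr.exists_walk_length_eq_dist
  have hd := fun {i : ℕ} (hi : i ≤ w.length) => dist_getVert_of_length_eq_dist w hw hi
  have hinj : ∀ {i j : ℕ}, i ≤ w.length → j ≤ w.length → w.getVert i = w.getVert j → i = j := by
    intro i j hi hj h
    rw [← hd hi, ← hd hj, h]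
  have hsucc : ∀ {i : ℕ}, i < w.length → K.Adj (w.getVert i) (w.getVert (i + 1)) :=
    fun hi => w.adj_getVert_succ hi
  have hlen : 2 ≤ w.length := by
    have h0 : w.length ≠ 0 := fun h => hne (SimpleGraph.Walk.eq_of_length_eq_zero h)
    have h1 : w.length ≠ 1 := fun h => hpq (SimpleGraph.Walk.adj_of_length_eq_one h).1
    omega
  have hW : ∀ {i : ℕ}, i ≤ w.length → w.getVert i ∈ D ∪ {p, q} := by
    intro i hi
    rcases Nat.lt_or_eq_of_le hi with h | h
    · exact (hsucc h).2.1
    · rw [h, w.getVert_length]; simp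
  have hint : ∀ {i : ℕ}, 0 < i → i < w.length → w.getVert i ∈ D := by
    intro i h0 hi
    rcases hW hi.le with h | h | h
    · exact h
    · have := hinj hi.le (Nat.zero_le _) (h.trans w.getVert_zero.symm); omega
    · have := hinj hi.le le_rfl (Eq.trans h w.getVert_length.symm); omega
  have hadj : ∀ {i j : ℕ}, i ≤ w.length → j ≤ w.length →
      (G.Adj (w.getVert i) (w.getVert j) ↔ i + 1 = j ∨ j + 1 = i) := by
    intro i j hi hj
    constructor
    · intro h
      have hKadj : K.Adj (w.getVert i) (w.getVert j) := ⟨h, hW hi, hW hj⟩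
      have h1 := hKadj.diff_dist_adj (u := p)
      have hij : i ≠ j := by rintro rfl; exact h.ne rfl
      rw [hd hi, hd hj] at h1
      omega
    · rintro (rfl | rfl)
      · exact (hsucc (by omega)).1
      · exact (hsucc (by omega)).1.symm
  have headj : ∀ {i : ℕ}, i ≤ w.length → (G.Adj e (w.getVert i) ↔ i = 0 ∨ i = w.length) := by
    intro i hi
    constructor
    · intro h
      by_contra! hc
      exact hD _ (hint (by omega) (by omega)) h
    · rintro (rfl | rfl)
      · simpa using hp
      · simpa using hq
  have hene : ∀ {i : ℕ}, i ≤ w.length → w.getVert i ≠ e := by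
    intro i hi h
    rcases hW hi with h' | h' | h'
    · exact heD (h ▸ h')
    · exact hp.ne (h.symm.trans h')
    · exact hq.ne (h.symm.trans h')
  by_cases h2 : w.length = 2
  · refine ⟨w.getVert 1, hint one_pos (by omega), ?_, ?_⟩
    · have := (hadj (i := 1) (j := 0) (by omega) (by omega)).2 (Or.inr rfl)
      simpa using this
    · have := (hadj (i := 1) (j := w.length) (by omega) le_rfl).2 (Or.inl h2.symm)
      simpa using this
  · exfalso
    refine hG (w.length + 2) (by omega)
      ⟨fun i => if i.val ≤ w.length then w.getVert i.val else e, ?_, ?_⟩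
    · intro i j hij
      have hi := i.isLt
      have hj := j.isLt
      apply Fin.ext
      dsimp only at hij
      split_ifs at hij with h h' h'
      · exact hinj h h' hij
      · exact absurd hij (hene h)
      · exact absurd hij.symm (hene h')
      · omega
    · intro i j
      have hi := i.isLt
      have hj := j.isLt
      have hmod : ∀ k : ℕ, k < w.length + 2 → (k + 1) % (w.length + 2) =
          if k = w.length + 1 then 0 else k + 1 := by
        intro k hk
        split_ifs with h
        · rw [h]; exact Nat.mod_self _
        · exact Nat.mod_eq_of_lt (by omega)
      rw [hmod _ hi, hmod _ hj]
      dsimp only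
      split_ifs <;> first
        | omega
        | exact (hadj (by omega) (by omega)).trans (by omega)
        | exact (headj (by omega)).trans (by omega)
        | exact (G.adj_comm _ _).trans ((headj (by omega)).trans (by omega))
        | exact iff_of_false G.irrefl (by omega)

/-- A chordal bipartite graph has no induced cycle of length six. -/
lemma ChordalBipartite.no_induced_six_cycle {G : SimpleGraph V} {A B : Set V}
    (hbip : IsBipartition G A B) (hG : ChordalBipartite G) {a₁ a₂ a₃ b₁ b₂ b₃ : V}
    (h₁₁ : G.Adj a₁ b₁) (h₂₁ : G.Adj a₂ b₁) (h₂₂ : G.Adj a₂ b₂) (h₃₂ : G.Adj a₃ b₂)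
    (h₃₃ : G.Adj a₃ b₃) (h₁₃ : G.Adj a₁ b₃) (h₁₂ : ¬ G.Adj a₁ b₂) (h₂₃ : ¬ G.Adj a₂ b₃)
    (h₃₁ : ¬ G.Adj a₃ b₁) : False := by
  obtain ⟨-, hdisj, hcol⟩ := hbip
  obtain ⟨c, hc⟩ : ∃ c : V → Prop, ∀ x y, G.Adj x y → (c x ↔ ¬ c y) :=
    ⟨(· ∈ A), fun x y h => by
      have := hcol h; have := hdisj x; have := hdisj y; tauto⟩
  have ha₂ : ¬ G.Adj a₁ a₂ := fun h => by
    have := hc _ _ h; have := hc _ _ h₁₁; have := hc _ _ h₂₁; tauto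
  have ha₃ : ¬ G.Adj a₁ a₃ := fun h => by
    have := hc _ _ h; have := hc _ _ h₁₃; have := hc _ _ h₃₃; tauto
  have ha₂₃ : ¬ G.Adj a₂ a₃ := fun h => by
    have := hc _ _ h; have := hc _ _ h₂₂; have := hc _ _ h₃₂; tauto
  have hb₁₂ : ¬ G.Adj b₁ b₂ := fun h => by
    have := hc _ _ h; have := hc _ _ h₂₁; have := hc _ _ h₂₂; tauto
  have hb₁₃ : ¬ G.Adj b₁ b₃ := fun h => by
    have := hc _ _ h; have := hc _ _ h₁₁; have := hc _ _ h₁₃; tauto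
  have hb₂₃ : ¬ G.Adj b₂ b₃ := fun h => by
    have := hc _ _ h; have := hc _ _ h₃₂; have := hc _ _ h₃₃; tauto
  have hadj : ∀ i j : Fin 6, G.Adj (![a₁, b₁, a₂, b₂, a₃, b₃] i) (![a₁, b₁, a₂, b₂, a₃, b₃] j) ↔
      ((i.val + 1) % 6 = j.val ∨ (j.val + 1) % 6 = i.val) := by
    intro i j
    fin_cases i <;> fin_cases j <;> simp [G.adj_comm, *]
  refine hG 6 (by norm_num) ⟨![a₁, b₁, a₂, b₂, a₃, b₃], fun i j hij => ?_, hadj⟩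
  have key : ∀ k : Fin 6, ((i.val + 1) % 6 = k.val ∨ (k.val + 1) % 6 = i.val) ↔
      ((j.val + 1) % 6 = k.val ∨ (k.val + 1) % 6 = j.val) := fun k => by
    rw [← hadj, ← hadj, hij]
  clear hij
  decide +revert

/-- A set `T` of vertices of `B`, any two of which have a common neighbor in `D`,
has a common neighbor in `D`. -/
lemma ChordalBipartite.exists_common_neighbor_of_pairwise [Fintype V] {G : SimpleGraph V}
    {A B : Set V} (hbip : IsBipartition G A B) (hG : ChordalBipartite G) {D T : Set V}
    (hD : D.Nonempty) (hT : ∀ t ∈ T, ∃ f ∈ D, G.Adj f t)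
    (hpair : ∀ p ∈ T, ∀ q ∈ T, p ≠ q → ∃ a ∈ D, G.Adj a p ∧ G.Adj a q) :
    ∃ g ∈ D, ∀ t ∈ T, G.Adj g t := by
  obtain ⟨g, hgD, hg⟩ := Set.exists_max_image D
    (fun g => {t | t ∈ T ∧ G.Adj g t}.ncard) (Set.toFinite _) hD
  refine ⟨g, hgD, fun q hqT => ?_⟩
  by_contra hgq
  obtain ⟨f, ⟨hfD, hfq⟩, hf⟩ := Set.exists_max_image {f | f ∈ D ∧ G.Adj f q}
    (fun f => {t | t ∈ T ∧ G.Adj f t ∧ G.Adj g t}.ncard) (Set.toFinite _) (hT q hqT)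
  obtain ⟨p, hpT, hgp, hfp⟩ : ∃ p ∈ T, G.Adj g p ∧ ¬ G.Adj f p := by
    by_contra! hc
    refine (hg f hfD).not_gt (Set.ncard_lt_ncard ?_ (Set.toFinite _))
    exact ⟨fun t ht => ⟨ht.1, hc t ht.1 ht.2⟩, fun h => hgq (h ⟨hqT, hfq⟩).2⟩
  obtain ⟨a, haD, hap, haq⟩ := hpair p hpT q hqT (by rintro rfl; exact hgq hgp)
  obtain ⟨r, hfr, hgr, har⟩ : ∃ r, G.Adj f r ∧ G.Adj g r ∧ ¬ G.Adj a r := by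
    by_contra! hc
    refine (hf a ⟨haD, haq⟩).not_gt (Set.ncard_lt_ncard ?_ (Set.toFinite _))
    exact ⟨fun t ht => ⟨ht.1, hc t ht.2.1 ht.2.2, ht.2.2⟩, fun h => hfp (h ⟨hpT, hap, hgp⟩).2.1⟩
  exact hG.no_induced_six_cycle hbip hap hgp hgr hfr hfq haq har hgq hfp

/-- `x` is a nest point with respect to `A'` and `B'`: the traces on `B'` of the neighborhoods of
its neighbors in `A'` form a chain. -/
def IsNestPoint (G : SimpleGraph V) (A' B' : Set V) (x : V) : Prop :=
  ∀ a ∈ A', ∀ a' ∈ A', G.Adj a x → G.Adj a' x →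
    (∀ b ∈ B', G.Adj a b → G.Adj a' b) ∨ (∀ b ∈ B', G.Adj a' b → G.Adj a b)

lemma IsNestPoint.of_sdiff_singleton {G : SimpleGraph V} {A' B' : Set V} {a₀ x : V}
    (h : IsNestPoint G (A' \ {a₀}) B' x) (hfull : ∀ b ∈ B', G.Adj a₀ b) :
    IsNestPoint G A' B' x := by
  intro a ha a' ha' hax hax'
  by_cases h1 : a = a₀
  · subst h1; exact Or.inr fun b hb _ => hfull b hb
  by_cases h2 : a' = a₀
  · subst h2; exact Or.inl fun b hb _ => hfull b hb
  exact h a ⟨ha, h1⟩ a' ⟨ha', h2⟩ hax hax'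

/-- If `e` is not adjacent to all of `B'`, some vertex of `B'` not adjacent to `e` is a nest
point. -/
lemma ChordalBipartite.exists_isNestPoint [Fintype V] {G : SimpleGraph V} {A B : Set V}
    (hbip : IsBipartition G A B) (hG : ChordalBipartite G) (n : ℕ) :
    ∀ A' B' : Set V, A' ⊆ A → B' ⊆ B → A'.ncard + B'.ncard = n →
      ∀ e ∈ A', ∀ y ∈ B', ¬ G.Adj e y → ∃ x ∈ B', ¬ G.Adj e x ∧ IsNestPoint G A' B' x := by
  have hAB : ∀ {a b : V}, a ∈ A → b ∈ B → a ≠ b := by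
    rintro a _ ha hb rfl; exact hbip.2.1 a ⟨ha, hb⟩
  have hAA : ∀ {a b : V}, a ∈ A → b ∈ A → ¬ G.Adj a b := by
    intro a b ha hb h
    rcases hbip.2.2 h with h' | h'
    · exact hAB hb h'.2 rfl
    · exact hAB ha h'.1 rfl
  have hBB : ∀ {a b : V}, a ∈ B → b ∈ B → ¬ G.Adj a b := by
    intro a b ha hb h
    rcases hbip.2.2 h with h' | h'
    · exact hAB h'.1 ha rfl
    · exact hAB h'.2 hb rfl
  induction n using Nat.strong_induction_on with
  | _ n ih =>
  intro A' B' hA' hB' hn e₀ he₀ y₀ hy₀ hey₀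
  by_cases hfull : ∃ a ∈ A', ∀ b ∈ B', G.Adj a b
  · obtain ⟨a, ha, hab⟩ := hfull
    have hne : e₀ ≠ a := by rintro rfl; exact hey₀ (hab _ hy₀)
    have hlt : (A' \ {a}).ncard < A'.ncard := Set.ncard_sdiff_singleton_lt_of_mem ha
    obtain ⟨x, hx, hex, hnest⟩ := ih _ (by omega) (A' \ {a}) B'
      (Set.sdiff_subset.trans hA') hB' rfl e₀ ⟨he₀, hne⟩ y₀ hy₀ hey₀
    exact ⟨x, hx, hex, hnest.of_sdiff_singleton hab⟩
  push Not at hfull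
  obtain ⟨e, ⟨he, hsub⟩, hmax⟩ := Set.exists_max_image
    {e | e ∈ A' ∧ ∀ b ∈ B', G.Adj e₀ b → G.Adj e b}
    (fun e => {b | b ∈ B' ∧ G.Adj e b}.ncard) (Set.toFinite _) ⟨e₀, he₀, fun _ _ h => h⟩
  suffices ∃ x ∈ B', ¬ G.Adj e x ∧ IsNestPoint G A' B' x by
    obtain ⟨x, hx, hex, hnest⟩ := this
    exact ⟨x, hx, fun h => hex (hsub x hx h), hnest⟩
  obtain ⟨y, hy, hey⟩ := hfull e he
  by_cases hiso : ∃ g ∈ A', G.Adj g y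
  swap
  · push Not at hiso
    exact ⟨y, hy, hey, fun a ha _ _ h => absurd h (hiso a ha)⟩
  obtain ⟨g₀, hg₀, hg₀y⟩ := hiso
  set S : Set V := {v | (v ∈ A' ∨ v ∈ B') ∧ v ≠ e ∧ ¬ G.Adj e v}
  set H := restrictEdges G S
  set D : Set V := {v | v ∈ S ∧ H.Reachable y v}
  have hyS : y ∈ S := ⟨Or.inr hy, (hAB (hA' he) (hB' hy)).symm, hey⟩
  have hyD : y ∈ D := ⟨hyS, SimpleGraph.Reachable.refl y⟩
  have hstep : ∀ {u v : V}, u ∈ D → v ∈ S → G.Adj u v → v ∈ D := fun hu hv h =>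
    ⟨hv, hu.2.trans (SimpleGraph.Adj.reachable (G := H) ⟨h, hu.1, hv⟩)⟩
  have hAS : ∀ {a b : V}, a ∈ A' → b ∈ D → G.Adj a b → a ∈ D := by
    intro a b ha hb hab
    refine hstep hb ⟨Or.inl ha, ?_, hAA (hA' he) (hA' ha)⟩ hab.symm
    rintro rfl
    exact hb.1.2.2 hab
  have hDA : ∀ {a b : V}, a ∈ D → b ∈ B' → G.Adj a b → a ∈ A' := by
    intro a b ha hb hab
    exact ha.1.1.resolve_right fun h => hBB (hB' h) (hB' hb) hab
  set T : Set V := {b | b ∈ B' ∧ G.Adj e b ∧ ∃ f ∈ D, G.Adj f b}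
  have hpair : ∀ p ∈ T, ∀ q ∈ T, p ≠ q → ∃ a ∈ D ∩ A', G.Adj a p ∧ G.Adj a q := by
    rintro p ⟨hpB, hep, f, hf, hfp⟩ q ⟨hqB, heq, f', hf', hfq⟩ hpq
    have hlift : ∀ {v : V}, v ∈ D → (restrictEdges G (D ∪ {p, q})).Reachable y v := by
      intro v hv
      have hr := (SimpleGraph.reachable_iff_reflTransGen y v).1 hv.2
      clear hv
      induction hr with
      | refl => exact SimpleGraph.Reachable.refl y
      | @tail b c hyb hbc IH =>
        have hb : b ∈ D := ⟨hbc.2.1, (SimpleGraph.reachable_iff_reflTransGen y b).2 hyb⟩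
        exact IH.trans (SimpleGraph.Adj.reachable
          ⟨hbc.1, Or.inl hb, Or.inl (hstep hb hbc.2.2 hbc.1)⟩)
    have hpf : (restrictEdges G (D ∪ {p, q})).Adj p f := ⟨hfp.symm, by simp, Or.inl hf⟩
    have hqf : (restrictEdges G (D ∪ {p, q})).Adj f' q := ⟨hfq, Or.inl hf', by simp⟩
    obtain ⟨a, haD, hap, haq⟩ := hG.exists_common_neighbor (D := D)
      (hBB (hB' hpB) (hB' hqB)) hpq hep heq (fun h => h.1.2.1 rfl) (fun v hv => hv.1.2.2)
      (hpf.reachable.trans ((hlift hf).symm.trans ((hlift hf').trans hqf.reachable)))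
    exact ⟨a, ⟨haD, hDA haD hpB hap⟩, hap, haq⟩
  obtain ⟨g, ⟨hgD, hgA⟩, hgT⟩ := hG.exists_common_neighbor_of_pairwise hbip (D := D ∩ A')
    (T := T) ⟨g₀, hAS hg₀ hyD hg₀y, hg₀⟩
    (fun t ⟨ht, _, f, hf, hft⟩ => ⟨f, ⟨hf, hDA hf ht hft⟩, hft⟩) hpair
  obtain ⟨z, hzD, hgz⟩ : ∃ z ∈ D, G.Adj g z := by
    have hgy : g ≠ y := hAB (hA' hgA) (hB' hy)
    obtain ⟨z, hgz, -⟩ := hgD.2.symm.exists_isPath.elim fun w _ => by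
      cases w with
      | nil => exact absurd rfl hgy
      | cons h t => exact (⟨_, h, trivial⟩ : ∃ z, H.Adj g z ∧ True)
    exact ⟨z, hstep hgD hgz.2.2 hgz.1, hgz.1⟩
  have hzB : z ∈ B' := hzD.1.1.resolve_left fun h => hAA (hA' hgA) (hA' h) hgz
  have hcover : ∀ {a b : V}, a ∈ D → b ∈ B' → G.Adj a b → b ∈ (B' ∩ D) ∪ T := by
    intro a b ha hb hab
    by_cases heb : G.Adj e b
    · exact Or.inr ⟨hb, heb, a, ha, hab⟩
    · exact Or.inl ⟨hb, hstep ha ⟨Or.inr hb, (hAB (hA' he) (hB' hb)).symm, heb⟩ hab⟩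
  have hss : (B' ∩ D) ∪ T ⊂ B' := by
    refine ⟨Set.union_subset Set.inter_subset_left fun b hb => hb.1, fun hle => ?_⟩
    have hsup : ∀ b ∈ B', G.Adj e b → G.Adj g b := by
      intro b hb heb
      rcases hle hb with h | h
      · exact absurd heb h.2.1.2.2
      · exact hgT b h
    refine (hmax g ⟨hgA, fun b hb h => hsup b hb (hsub b hb h)⟩).not_gt
      (Set.ncard_lt_ncard ?_ (Set.toFinite _))
    exact ⟨fun b hb => ⟨hb.1, hsup b hb.1 hb.2⟩, fun h => hzD.1.2.2 (h ⟨hzB, hgz⟩).2⟩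
  have hlt := Set.ncard_lt_ncard hss (Set.toFinite _)
  obtain ⟨x, hx, hex, hnest⟩ := ih _ (by omega) A' ((B' ∩ D) ∪ T) hA' (hss.1.trans hB') rfl
    e he y (Or.inl ⟨hy, hyD⟩) hey
  have hxD : x ∈ D := by
    rcases hx with h | h
    · exact h.2
    · exact absurd h.2.1 hex
  refine ⟨x, hss.1 hx, hex, fun a ha a' ha' hax hax' => ?_⟩
  have haD := hAS ha hxD hax
  have haD' := hAS ha' hxD hax'
  exact (hnest a ha a' ha' hax hax').imp
    (fun h b hb hab => h b (hcover haD hb hab) hab)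
    (fun h b hb hab => h b (hcover haD' hb hab) hab)

/-- A vertex is simple if the closed neighborhoods of the vertices in its closed neighborhood are
pairwise comparable. -/
lemma isSimpleVertex_of_comparable [Fintype V] {G : SimpleGraph V} {x : V}
    (h : ∀ a ∈ closedNbhd G x, ∀ b ∈ closedNbhd G x,
      closedNbhd G a ⊆ closedNbhd G b ∨ closedNbhd G b ⊆ closedNbhd G a) :
    IsSimpleVertex G x := by
  classical
  let r : V → V → Prop := fun a b => (closedNbhd G a).ncard ≤ (closedNbhd G b).ncard
  have hperm := List.perm_insertionSort r (closedNbhd G x).toFinset.toList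
  have hmem : ∀ v, v ∈ List.insertionSort r (closedNbhd G x).toFinset.toList ↔
      v ∈ closedNbhd G x := fun v => by rw [hperm.mem_iff]; simp
  have : Std.Total r := ⟨fun a b => le_total _ _⟩
  have : IsTrans V r := ⟨fun a b c => le_trans⟩
  refine ⟨_, hperm.nodup_iff.2 (Finset.nodup_toList _), hmem, List.Pairwise.isChain ?_⟩
  refine (List.pairwise_insertionSort r _).imp_of_mem fun {a b} ha hb hab => ?_
  rcases h a ((hmem a).1 ha) b ((hmem b).1 hb) with h' | h'
  · exact h'
  · exact (Set.eq_of_subset_of_ncard_le h' hab (Set.toFinite _)).ge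

/-- If `G = (A, B, E)` is chordal bipartite and `B ≠ ∅` then `B` contains a vertex that is
simple in `G_A`. -/
theorem exists_simple_vertex_in_B [Fintype V]
    (G : SimpleGraph V) (A B : Set V) (hbip : IsBipartition G A B)
    (hG : ChordalBipartite G) (hB : B.Nonempty) :
    ∃ x ∈ B, IsSimpleVertex (addCompleteOn G A) x := by
  have hnest : ∃ x ∈ B, IsNestPoint G A B x := by
    by_cases h : ∃ e ∈ A, ∃ y ∈ B, ¬ G.Adj e y
    · obtain ⟨e, he, y, hy, hey⟩ := h
      obtain ⟨x, hx, -, hnest⟩ := hG.exists_isNestPoint hbip _ A B subset_rfl subset_rfl rfl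
        e he y hy hey
      exact ⟨x, hx, hnest⟩
    · push Not at h
      obtain ⟨x, hx⟩ := hB
      exact ⟨x, hx, fun a ha a' ha' _ _ => Or.inl fun b hb _ => h a' ha' b hb⟩
  obtain ⟨x, hx, hnest⟩ := hnest
  obtain ⟨hcov, hdisj, hcol⟩ := hbip
  have hadj : ∀ u v, (addCompleteOn G A).Adj u v ↔ u ≠ v ∧ (G.Adj u v ∨ u ∈ A ∧ v ∈ A) := by
    intro u v
    simp only [addCompleteOn, SimpleGraph.fromRel_adj, G.adj_comm v u]
    tauto
  have hxA : x ∉ A := fun h => hdisj x ⟨h, hx⟩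
  have hNx : ∀ v, v ∈ closedNbhd (addCompleteOn G A) x ↔ v = x ∨ (v ∈ A ∧ G.Adj v x) := by
    intro v
    simp only [closedNbhd, Set.mem_insert_iff, SimpleGraph.mem_neighborSet, hadj, G.adj_comm x v]
    constructor
    · rintro (h | ⟨-, h | h⟩)
      · exact Or.inl h
      · rcases hcol h with h' | h'
        · exact Or.inr ⟨h'.1, h⟩
        · exact absurd h'.2 hxA
      · exact absurd h.1 hxA
    · rintro (h | h)
      · exact Or.inl h
      · exact Or.inr ⟨h.2.ne', Or.inl h.2⟩
  have hNa : ∀ a ∈ A, ∀ v, v ∈ closedNbhd (addCompleteOn G A) a ↔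
      v ∈ A ∨ (v ∈ B ∧ G.Adj a v) := by
    intro a ha v
    simp only [closedNbhd, Set.mem_insert_iff, SimpleGraph.mem_neighborSet, hadj]
    constructor
    · rintro (rfl | ⟨-, h | h⟩)
      · exact Or.inl ha
      · rcases hcol h with h' | h'
        · exact Or.inr ⟨h'.2, h⟩
        · exact Or.inl h'.2
      · exact Or.inl h.2
    · rintro (h | h)
      · by_cases hv : v = a
        · exact Or.inl hv
        · exact Or.inr ⟨Ne.symm hv, Or.inr ⟨ha, h⟩⟩
      · exact Or.inr ⟨h.2.ne, Or.inl h.2⟩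
  have hmin : ∀ a ∈ A, G.Adj a x →
      closedNbhd (addCompleteOn G A) x ⊆ closedNbhd (addCompleteOn G A) a := by
    intro a ha hax v hv
    rw [hNa a ha]
    rcases (hNx v).1 hv with rfl | h
    · exact Or.inr ⟨hx, hax⟩
    · exact Or.inl h.1
  have hmono : ∀ a ∈ A, ∀ a' ∈ A, (∀ b ∈ B, G.Adj a b → G.Adj a' b) →
      closedNbhd (addCompleteOn G A) a ⊆ closedNbhd (addCompleteOn G A) a' := by
    intro a ha a' ha' h v hv
    rw [hNa a' ha']
    exact ((hNa a ha v).1 hv).imp_right fun hv => ⟨hv.1, h v hv.1 hv.2⟩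
  refine ⟨x, hx, isSimpleVertex_of_comparable fun a ha b hb => ?_⟩
  rcases (hNx a).1 ha with rfl | ⟨haA, hax⟩
  · rcases (hNx b).1 hb with rfl | ⟨hbA, hbx⟩
    · exact Or.inl subset_rfl
    · exact Or.inl (hmin b hbA hbx)
  · rcases (hNx b).1 hb with rfl | ⟨hbA, hbx⟩
    · exact Or.inr (hmin a haA hax)
    · exact (hnest a haA b hbA hax hbx).imp (hmono a haA b hbA) (hmono b hbA a haA)
end

section
/- Let G be a k-tree and let c be a proper coloring of the vertices of G with k+1 colors. Then for every nonempty subset S of the k+1 colors, the subgraph of G induced by the vertices whose color belongs to S is an (|S|−1)-tree. -/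
variable {V : Type*}

/-- `G` is a `k`-tree: there is a construction ordering of all vertices starting from a
clique on `k + 1` vertices, where each later vertex is adjacent to exactly a clique of
size `k` among the earlier vertices. -/
def IsKTree (k : ℕ) (G : SimpleGraph V) : Prop :=
  ∃ l : List V, l.Nodup ∧ (∀ v, v ∈ l) ∧ k + 1 ≤ l.length ∧
    G.IsClique {v | v ∈ l.take (k + 1)} ∧
    ∀ i (hi : i < l.length), k + 1 ≤ i →
      (G.neighborSet (l.get ⟨i, hi⟩) ∩ {v | v ∈ l.take i}).ncard = k ∧
      G.IsClique (G.neighborSet (l.get ⟨i, hi⟩) ∩ {v | v ∈ l.take i})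

/-- If the colors on a rainbow set `T` are exactly those in `A`, then the number of vertices of `T`
with color in `S` is `|A ∩ S|`. -/
theorem ncard_preimage_val_of_injOn {α : Type*} [DecidableEq α] (c : V → α) (S A : Finset α)
    (T : Set V) (hinj : Set.InjOn c T) (himg : c '' T = A) :
    ((Subtype.val : {v | c v ∈ S} → V) ⁻¹' T).ncard = (A ∩ S).card := by
  have hinj' : Set.InjOn (fun x : {v | c v ∈ S} => c x.1) (Subtype.val ⁻¹' T) :=
    fun x hx y hy h => Subtype.ext (hinj hx hy h)
  rw [← Set.InjOn.ncard_image hinj', ← Set.ncard_coe_finset]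
  congr 1
  ext a
  simp only [Set.mem_image, Set.mem_preimage, Finset.coe_inter, Set.mem_inter_iff, ← himg,
    Finset.mem_coe]
  constructor
  · rintro ⟨x, hx, rfl⟩
    exact ⟨⟨x.1, hx, rfl⟩, x.2⟩
  · rintro ⟨⟨v, hv, rfl⟩, hS⟩
    exact ⟨⟨v, hS⟩, hv, rfl⟩

/-- A finite set of `A.card` vertices with distinct colors, all in `A`, uses every color in `A`. -/
theorem image_eq_of_injOn_of_ncard_eq {α : Type*} (c : V → α) (A : Finset α)
    (T : Set V) (hinj : Set.InjOn c T) (hsub : c '' T ⊆ A) (hcard : T.ncard = A.card) :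
    c '' T = A := by
  apply Set.eq_of_subset_of_ncard_le hsub _ A.finite_toSet
  rw [Set.InjOn.ncard_image hinj, Set.ncard_coe_finset, hcard]

/-- The number of members of a duplicate-free list is its length. -/
theorem List.Nodup.ncard_setOf_mem {α : Type*} {l : List α} (h : l.Nodup) :
    {x | x ∈ l}.ncard = l.length := by
  classical
  rw [← List.toFinset_card_of_nodup h, ← Set.ncard_coe_finset]
  simp

/-- A proper coloring is injective on cliques. -/
theorem SimpleGraph.IsClique.injOn_of_proper {α : Type*} {G : SimpleGraph V} {c : V → α}
    (hc : ∀ ⦃u v⦄, G.Adj u v → c u ≠ c v) {T : Set V} (hT : G.IsClique T) : Set.InjOn c T :=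
  fun _ hx _ hy h => by_contra fun hne => hc (hT hx hy hne) h

/-- The preimage of a clique is a clique of the induced subgraph. -/
theorem SimpleGraph.IsClique.preimage_val {G : SimpleGraph V} {s T : Set V}
    (hT : G.IsClique T) : (G.induce s).IsClique (Subtype.val ⁻¹' T) :=
  fun _ hx _ hy hne => hT hx hy fun h => hne (Subtype.ext h)

/-- If `G` is a `k`-tree with a proper coloring by `k + 1` colors, then for every nonempty
subset `S` of the colors, the subgraph induced by the vertices colored from `S` is an
`(|S| - 1)`-tree. -/
theorem ktree_color_classes_induce_ktree (k : ℕ) (G : SimpleGraph V)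
    (hG : IsKTree k G) (c : V → Fin (k + 1)) (hc : ∀ ⦃u v⦄, G.Adj u v → c u ≠ c v)
    (S : Finset (Fin (k + 1))) (hS : S.Nonempty) :
    IsKTree (S.card - 1) (G.induce {v | c v ∈ S}) := by
  classical
  obtain ⟨l, hnd, hall, hlen, hcl, hstep⟩ := hG
  have hSpos : S.card - 1 + 1 = S.card := Nat.sub_add_cancel hS.card_pos
  let f : V → Option {v | c v ∈ S} := fun v => if h : c v ∈ S then some ⟨v, h⟩ else none
  have hf : ∀ v x, f v = some x ↔ v = x.1 := by
    intro v x
    by_cases h : c v ∈ S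
    · simp [f, h, Subtype.ext_iff]
    · simp only [f, h, dite_false, reduceCtorEq, false_iff]
      rintro rfl
      exact h x.2
  have hmem : ∀ (m : List V) x, x ∈ m.filterMap f ↔ x.1 ∈ m := by
    intro m x
    simp [List.mem_filterMap, hf]
  have hset : ∀ m : List V, {x | x ∈ m.filterMap f} = Subtype.val ⁻¹' {v | v ∈ m} :=
    fun m => Set.ext (hmem m)
  have hnd' : ∀ m : List V, m.Nodup → (m.filterMap f).Nodup := fun m hm =>
    hm.filterMap fun a b x ha hb => ((hf a x).1 ha).trans ((hf b x).1 hb).symm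
  have hinitlen : ((l.take (k + 1)).filterMap f).length = S.card := by
    have ht : (l.take (k + 1)).Nodup := hnd.sublist (List.take_sublist _ _)
    have hinj := hcl.injOn_of_proper hc
    rw [← (hnd' _ ht).ncard_setOf_mem, hset, ncard_preimage_val_of_injOn c S Finset.univ _ hinj,
      Finset.univ_inter]
    apply image_eq_of_injOn_of_ncard_eq c _ _ hinj (by simp)
    rw [ht.ncard_setOf_mem]
    simp [hlen]
  have hsplit : l.filterMap f =
      (l.take (k + 1)).filterMap f ++ (l.drop (k + 1)).filterMap f := by
    rw [← List.filterMap_append, List.take_append_drop]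
  refine ⟨l.filterMap f, hnd' l hnd, fun x => (hmem l x).2 (hall _), ?_, ?_, ?_⟩
  · rw [hSpos, hsplit, List.length_append, hinitlen]
    exact Nat.le_add_right _ _
  · rw [hSpos, hsplit, List.take_left' hinitlen, hset]
    exact hcl.preimage_val
  intro j hj hSj
  rw [hSpos] at hSj
  obtain ⟨a, b, w, hab, htake, hw⟩ : ∃ (a b : List V) (w : V), l = a ++ w :: b ∧
      a.filterMap f = (l.filterMap f).take j ∧ w = ((l.filterMap f).get ⟨j, hj⟩).1 := by
    have h : l.filterMap f = (l.filterMap f).take j ++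
        (l.filterMap f).get ⟨j, hj⟩ :: (l.filterMap f).drop (j + 1) := by
      simp
    obtain ⟨a₁, r, hl, ha₁, hr⟩ := List.filterMap_eq_append_iff.1 h
    obtain ⟨a₂, w, b, hr, ha₂, hw, -⟩ := List.filterMap_eq_cons_iff.1 hr
    refine ⟨a₁ ++ a₂, b, w, by simp [hl, hr], ?_, (hf _ _).1 hw⟩
    rw [List.filterMap_append, ha₁, List.filterMap_eq_nil_iff.2 ha₂, List.append_nil]
  generalize (l.filterMap f).get ⟨j, hj⟩ = x at hw
  have hlena : a.length < l.length := by simp [hab]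
  have hka : k + 1 ≤ a.length := by
    by_contra! hlt
    have hpre : a ++ [w] <+: l.take (k + 1) := by
      rw [List.prefix_take_iff]
      exact ⟨⟨b, by simp [hab]⟩, by simpa using hlt⟩
    have hle := (hpre.sublist.filterMap f).length_le
    rw [hinitlen, List.filterMap_append, htake, List.length_append, List.length_take,
      List.filterMap_cons_some ((hf w x).2 hw)] at hle
    simp only [List.filterMap_nil, List.length_singleton] at hle
    omega
  have hget : l.get ⟨a.length, hlena⟩ = w := by simp [hab]
  have htakea : l.take a.length = a := by simp [hab]
  obtain ⟨hcard, hclq⟩ := hstep a.length hlena hka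
  rw [hget, htakea] at hcard hclq
  have hnbr : (G.induce {v | c v ∈ S}).neighborSet x ∩ {y | y ∈ (l.filterMap f).take j} =
      Subtype.val ⁻¹' (G.neighborSet w ∩ {v | v ∈ a}) := by
    rw [← htake, hset, hw]
    rfl
  rw [hnbr]
  refine ⟨?_, hclq.preimage_val⟩
  have hinj := hclq.injOn_of_proper hc
  rw [ncard_preimage_val_of_injOn c S {c w}ᶜ _ hinj]
  · rw [Finset.inter_comm, ← Finset.sdiff_eq_inter_compl, Finset.sdiff_singleton_eq_erase,
      Finset.card_erase_of_mem]
    rw [hw]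
    exact x.2
  · apply image_eq_of_injOn_of_ncard_eq c _ _ hinj
    · rintro _ ⟨u, ⟨hu, -⟩, rfl⟩
      simpa using (hc hu).symm
    · rw [hcard, Finset.card_compl]
      simp
end

section
/- Let G be a k-tree. Then the proper coloring of G with k+1 colors is unique up to a permutation of the colors: if c_1 and c_2 are two proper colorings of G each using the same set of k+1 colors, then there exists a permutation π of the colors such that c_2(v) = π(c_1(v)) for every vertex v of G. -/
variable {V : Type*}

/-- In a proper colouring with `k + 1` colours, a vertex joined to a clique of size `k` receives
the unique colour missing from that clique. -/
theorem compl_image_eq_singleton_of_isClique {k : ℕ} {G : SimpleGraph V} {c : V → Fin (k + 1)}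
    (hc : ∀ ⦃u v⦄, G.Adj u v → c u ≠ c v) {S : Set V} (hS : S.ncard = k) (hcl : G.IsClique S)
    {v : V} (hv : S ⊆ G.neighborSet v) : (c '' S)ᶜ = {c v} := by
  have hinj : Set.InjOn c S := fun a ha b hb hab => by
    by_contra hne
    exact hc (hcl ha hb hne) hab
  have hcard : (c '' S)ᶜ.ncard = 1 := by
    rw [Set.ncard_compl, hinj.ncard_image, hS, Nat.card_eq_fintype_card,
      Fintype.card_fin]
    omega
  obtain ⟨a, ha⟩ := Set.ncard_eq_one.mp hcard
  have hmem : c v ∈ (c '' S)ᶜ := by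
    rintro ⟨u, hu, huv⟩
    exact hc (hv hu) huv.symm
  rw [ha, Set.mem_singleton_iff] at hmem
  rw [ha, hmem]

/-- A proper colouring with `k + 1` colours is bijective on a listed clique of size `k + 1`. -/
theorem bijective_comp_get_of_isClique {k : ℕ} {G : SimpleGraph V} {c : V → Fin (k + 1)}
    (hc : ∀ ⦃u v⦄, G.Adj u v → c u ≠ c v) {l : List V} (hl : l.Nodup) (hk : k + 1 ≤ l.length)
    (hcl : G.IsClique {v | v ∈ l.take (k + 1)}) :
    Function.Bijective fun i : Fin (k + 1) => c (l.get (i.castLE hk)) := by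
  refine Finite.injective_iff_bijective.mp fun i j hij => ?_
  by_contra hne
  have hmem (m : Fin (k + 1)) : l.get (m.castLE hk) ∈ l.take (k + 1) :=
    List.mem_take_iff_getElem.mpr ⟨m, by have := m.2; omega, rfl⟩
  refine hc (hcl (hmem i) (hmem j) fun h => hne ?_) hij
  exact Fin.castLE_injective hk (hl.injective_get h)

/-- The proper coloring of a `k`-tree with `k + 1` colors is unique up to a permutation of
the colors. -/
theorem ktree_coloring_unique (k : ℕ) (G : SimpleGraph V) (hG : IsKTree k G)
    (c₁ c₂ : V → Fin (k + 1))
    (h₁ : ∀ ⦃u v⦄, G.Adj u v → c₁ u ≠ c₁ v)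
    (h₂ : ∀ ⦃u v⦄, G.Adj u v → c₂ u ≠ c₂ v) :
    ∃ π : Equiv.Perm (Fin (k + 1)), ∀ v, c₂ v = π (c₁ v) := by
  obtain ⟨l, hl, hmem, hk, hcl, hstep⟩ := hG
  let e₁ := Equiv.ofBijective _ (bijective_comp_get_of_isClique h₁ hl hk hcl)
  let e₂ := Equiv.ofBijective _ (bijective_comp_get_of_isClique h₂ hl hk hcl)
  let π : Equiv.Perm (Fin (k + 1)) := e₁.symm.trans e₂
  have key (i : ℕ) (hi : i < l.length) : c₂ l[i] = π (c₁ l[i]) := by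
    induction i using Nat.strong_induction_on with
    | _ i ih =>
      by_cases hik : i < k + 1
      · change e₂ ⟨i, hik⟩ = e₂ (e₁.symm (e₁ ⟨i, hik⟩))
        rw [Equiv.symm_apply_apply]
      · obtain ⟨hS, hScl⟩ := hstep i hi (not_lt.mp hik)
        have hE₁ := compl_image_eq_singleton_of_isClique h₁ hS hScl Set.inter_subset_left
        have hE₂ := compl_image_eq_singleton_of_isClique h₂ hS hScl Set.inter_subset_left
        have himg : Set.EqOn c₂ (π ∘ c₁)
            (G.neighborSet (l.get ⟨i, hi⟩) ∩ {v | v ∈ l.take i}) := by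
          rintro v ⟨-, hv⟩
          obtain ⟨j, hj, rfl⟩ := List.mem_take_iff_getElem.mp hv
          exact ih j (by omega) (by omega)
        rw [himg.image_eq, Set.image_comp, ← Set.image_compl_eq π.bijective, hE₁,
          Set.image_singleton] at hE₂
        exact (Set.singleton_injective hE₂).symm
  refine ⟨π, fun v => ?_⟩
  obtain ⟨i, hi, rfl⟩ := List.getElem_of_mem (hmem v)
  exact key i hi
end

section
/- Let G = (A,B,E) be a chordal bipartite graph. Let G_B^* be the graph obtained from G by adding edges so that for every vertex x ∈ A the set N(x) becomes a clique. Then G_B^* is strongly chordal. -/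
variable {V : Type*}

/-- The graph `G_B^*` obtained from `G` by adding edges so that the neighborhood of every
vertex of `A` becomes a clique. -/
def cliqueNeighborhoods (G : SimpleGraph V) (A : Set V) : SimpleGraph V :=
  SimpleGraph.fromRel fun u v => G.Adj u v ∨ ∃ x ∈ A, G.Adj x u ∧ G.Adj x v

theorem succ_mod_eq_ite {i n : ℕ} (h : i < n) :
    (i + 1) % n = if i + 1 = n then 0 else i + 1 := by
  split_ifs with h'
  · simp [h']
  · exact Nat.mod_eq_of_lt (by omega)

section Bipartite

variable {G : SimpleGraph V} {A B : Set V}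

theorem IsBipartition.mem_right_s11 (hbip : IsBipartition G A B) {x u : V} (hx : x ∈ A)
    (h : G.Adj x u) : u ∈ B := by
  rcases hbip.2.2 h with h' | h'
  · exact h'.2
  · exact absurd ⟨hx, h'.1⟩ (hbip.2.1 x)

theorem IsBipartition.mem_right_of_notMem_left (hbip : IsBipartition G A B) {v : V}
    (hv : v ∉ A) : v ∈ B :=
  (hbip.1 v).resolve_left hv

theorem IsBipartition.not_adj_left_s11 (hbip : IsBipartition G A B) {x y : V} (hx : x ∈ A)
    (hy : y ∈ A) : ¬ G.Adj x y :=
  fun h => hbip.2.1 y ⟨hy, hbip.mem_right_s11 hx h⟩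

theorem IsBipartition.not_adj_right (hbip : IsBipartition G A B) {x y : V} (hx : x ∈ B)
    (hy : y ∈ B) : ¬ G.Adj x y := by
  intro h
  rcases hbip.2.2 h with h' | h'
  · exact hbip.2.1 x ⟨h'.1, hx⟩
  · exact hbip.2.1 y ⟨h'.2, hy⟩

/-- A chordal bipartite graph has no induced cycle of length `2 * k ≥ 6`, the cycle being given by
its vertices `b i` on one side and `t i` on the other, with `t i` between `b i` and `b (i + 1)`. -/
theorem ChordalBipartite.not_alternating_cycle (hbip : IsBipartition G A B)
    (hG : ChordalBipartite G) {k : ℕ} (hk : 3 ≤ k) (b t : Fin k → V)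
    (hb : Function.Injective b) (hbB : ∀ i, b i ∈ B) (htA : ∀ i, t i ∈ A)
    (hadj : ∀ i j : Fin k, G.Adj (t i) (b j) ↔ (j.val = i.val ∨ j.val = (i.val + 1) % k)) :
    False := by
  have ht : Function.Injective t := by
    intro i j hij
    have h1 : G.Adj (t j) (b i) := hij ▸ (hadj i i).2 (Or.inl rfl)
    have h2 : G.Adj (t i) (b j) := hij ▸ (hadj j j).2 (Or.inl rfl)
    rw [hadj, succ_mod_eq_ite (by omega)] at h1 h2
    ext
    split_ifs at h1 h2 <;> omega
  have hne : ∀ i j, b i ≠ t j := fun i j h => hbip.2.1 (b i) ⟨h ▸ htA j, hbB i⟩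
  let f : Fin (2 * k) → V := fun m =>
    if m.val % 2 = 0 then b ⟨m.val / 2, by omega⟩ else t ⟨m.val / 2, by omega⟩
  refine hG (2 * k) (by omega) ⟨f, ?_, ?_⟩
  · intro m n hmn
    simp only [f] at hmn
    ext
    split_ifs at hmn with h1 h2 h2
    · have := congrArg Fin.val (hb hmn)
      dsimp only at this
      omega
    · exact absurd hmn (hne _ _)
    · exact absurd hmn.symm (hne _ _)
    · have := congrArg Fin.val (ht hmn)
      dsimp only at this
      omega
  · intro m n
    have hm := m.isLt
    have hn := n.isLt
    rw [succ_mod_eq_ite hm, succ_mod_eq_ite hn]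
    simp only [f]
    split_ifs with h1 h2 h2 <;>
      first
      | (refine iff_of_false (hbip.not_adj_right (hbB _) (hbB _)) ?_; omega)
      | (refine iff_of_false (hbip.not_adj_left_s11 (htA _) (htA _)) ?_; omega)
      | (rw [G.adj_comm, hadj, succ_mod_eq_ite (by dsimp only; omega)]
         dsimp only
         split_ifs <;> omega)
      | (rw [hadj, succ_mod_eq_ite (by dsimp only; omega)]
         dsimp only
         split_ifs <;> omega)

/-- In a chordal bipartite graph, three vertices of `B` with pairwise common neighbors in `A` have
a common neighbor. -/
theorem ChordalBipartite.exists_common_neighbor_s11 (hbip : IsBipartition G A B)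
    (hG : ChordalBipartite G) {u v w x y z : V} (hu : u ∈ B) (hv : v ∈ B) (hw : w ∈ B)
    (huv : u ≠ v) (hvw : v ≠ w) (hwu : w ≠ u) (hx : x ∈ A) (hy : y ∈ A) (hz : z ∈ A)
    (hxu : G.Adj x u) (hxv : G.Adj x v) (hyv : G.Adj y v) (hyw : G.Adj y w)
    (hzw : G.Adj z w) (hzu : G.Adj z u) :
    ∃ a ∈ A, G.Adj a u ∧ G.Adj a v ∧ G.Adj a w := by
  by_contra! hno
  have hxw : ¬ G.Adj x w := hno x hx hxu hxv
  have hyu : ¬ G.Adj y u := fun h => hno y hy h hyv hyw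
  have hzv : ¬ G.Adj z v := fun h => hno z hz hzu h hzw
  refine hG.not_alternating_cycle hbip le_rfl ![u, v, w] ![x, y, z] ?_ ?_ ?_ ?_
  · intro i j
    fin_cases i <;> fin_cases j <;> simp [huv, hvw, hwu, huv.symm, hvw.symm, hwu.symm]
  · intro i
    fin_cases i <;> assumption
  · intro i
    fin_cases i <;> assumption
  · intro i j
    fin_cases i <;> fin_cases j <;> simp [*]

theorem cliqueNeighborhoods_adj_of_common {x u v : V} (hx : x ∈ A) (hu : G.Adj x u)
    (hv : G.Adj x v) (huv : u ≠ v) : (cliqueNeighborhoods G A).Adj u v :=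
  (SimpleGraph.fromRel_adj _ _ _).2 ⟨huv, Or.inl (Or.inr ⟨x, hx, hu, hv⟩)⟩

theorem adj_of_cliqueNeighborhoods_adj (hbip : IsBipartition G A B) {x u : V} (hx : x ∈ A)
    (h : (cliqueNeighborhoods G A).Adj x u) : G.Adj x u := by
  rcases ((SimpleGraph.fromRel_adj _ _ _).1 h).2 with (h | ⟨y, hy, h, -⟩) | (h | ⟨y, hy, -, h⟩)
  · exact h
  · exact absurd h (hbip.not_adj_left_s11 hy hx)
  · exact h.symm
  · exact absurd h (hbip.not_adj_left_s11 hy hx)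

theorem exists_common_of_cliqueNeighborhoods_adj (hbip : IsBipartition G A B) {u v : V}
    (hu : u ∈ B) (hv : v ∈ B) (h : (cliqueNeighborhoods G A).Adj u v) :
    ∃ x ∈ A, G.Adj x u ∧ G.Adj x v := by
  rcases ((SimpleGraph.fromRel_adj _ _ _).1 h).2 with (h | ⟨y, hy, h⟩) | (h | ⟨y, hy, h⟩)
  · exact absurd h (hbip.not_adj_right hu hv)
  · exact ⟨y, hy, h⟩
  · exact absurd h (hbip.not_adj_right hv hu)
  · exact ⟨y, hy, h.symm⟩

/-- Vertices of `A` are simplicial in `cliqueNeighborhoods G A`. -/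
theorem mem_right_of_not_simplicial (hbip : IsBipartition G A B) {x u v : V}
    (hu : (cliqueNeighborhoods G A).Adj x u) (hv : (cliqueNeighborhoods G A).Adj x v)
    (hne : u ≠ v) (huv : ¬ (cliqueNeighborhoods G A).Adj u v) : x ∈ B :=
  hbip.mem_right_of_notMem_left fun hx =>
    huv (cliqueNeighborhoods_adj_of_common hx (adj_of_cliqueNeighborhoods_adj hbip hx hu)
      (adj_of_cliqueNeighborhoods_adj hbip hx hv) hne)

theorem ChordalBipartite.isChordalGraph_cliqueNeighborhoods (hbip : IsBipartition G A B)
    (hG : ChordalBipartite G) : IsChordalGraph (cliqueNeighborhoods G A) := by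
  rintro n hn ⟨f, hf, hadj⟩
  let next : Fin n → Fin n := fun i => ⟨(i.val + 1) % n, Nat.mod_lt _ (by omega)⟩
  have hval : ∀ i : Fin n, (i.val + 1 = n ∧ (next i).val = 0) ∨
      (i.val + 1 < n ∧ (next i).val = i.val + 1) := by
    intro i
    simp only [next, succ_mod_eq_ite i.isLt]
    split_ifs <;> omega
  have hnext : ∀ i, (cliqueNeighborhoods G A).Adj (f i) (f (next i)) :=
    fun i => (hadj _ _).2 (Or.inl rfl)
  have hB_next : ∀ i, f (next i) ∈ B := by
    intro i
    refine mem_right_of_not_simplicial hbip (hnext i).symm (hnext (next i)) (hf.ne ?_) ?_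
    · intro h
      have h := congrArg Fin.val h
      have := hval i
      have := hval (next i)
      omega
    · rw [hadj, succ_mod_eq_ite i.isLt, succ_mod_eq_ite (next (next i)).isLt]
      have := hval i
      have := hval (next i)
      split_ifs <;> omega
  have hB : ∀ i, f i ∈ B := by
    intro i
    have hi : next ⟨(i.val + (n - 1)) % n, Nat.mod_lt _ (by omega)⟩ = i := by
      ext
      simp only [next, Nat.mod_add_mod]
      rw [show i.val + (n - 1) + 1 = i.val + n by omega, Nat.add_mod_right,
        Nat.mod_eq_of_lt i.isLt]
    exact hi ▸ hB_next _
  choose t htA ht ht' using fun i =>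
    exists_common_of_cliqueNeighborhoods_adj hbip (hB i) (hB (next i)) (hnext i)
  refine hG.not_alternating_cycle hbip (by omega) f t hf hB htA fun i j => ⟨fun h => ?_, ?_⟩
  · by_contra! hj
    have h1 := (hadj i j).1 (cliqueNeighborhoods_adj_of_common (htA i) (ht i) h
      (hf.ne fun h => hj.1 (congrArg Fin.val h.symm)))
    have h2 := (hadj (next i) j).1 (cliqueNeighborhoods_adj_of_common (htA i) (ht' i) h
      (hf.ne fun h => hj.2 (congrArg Fin.val h.symm)))
    rw [succ_mod_eq_ite i.isLt, succ_mod_eq_ite j.isLt] at h1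
    rw [succ_mod_eq_ite (next i).isLt, succ_mod_eq_ite j.isLt] at h2
    rw [succ_mod_eq_ite i.isLt] at hj
    have := hval i
    split_ifs at h1 h2 hj <;> omega
  · rintro (h | h)
    · rw [Fin.ext h]
      exact ht i
    · rw [show j = next i from Fin.ext h]
      exact ht' i

theorem ChordalBipartite.not_hasInducedSun_cliqueNeighborhoods (hbip : IsBipartition G A B)
    (hG : ChordalBipartite G) {k : ℕ} (hk : 3 ≤ k) :
    ¬ HasInducedSun (cliqueNeighborhoods G A) k := by
  rintro ⟨c, s, hc, hs, hcs, hcc, hsc, hss⟩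
  let next : Fin k → Fin k := fun i => ⟨(i.val + 1) % k, Nat.mod_lt _ (by omega)⟩
  have hne : ∀ i, i ≠ next i := by
    intro i h
    have h := congrArg Fin.val h
    simp only [next, succ_mod_eq_ite i.isLt] at h
    split_ifs at h <;> omega
  have hs1 : ∀ i, (cliqueNeighborhoods G A).Adj (s i) (c i) := fun i => (hsc _ _).2 (Or.inl rfl)
  have hs2 : ∀ i, (cliqueNeighborhoods G A).Adj (s i) (c (next i)) :=
    fun i => (hsc _ _).2 (Or.inr rfl)
  have hB_next : ∀ i, c (next i) ∈ B := fun i =>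
    mem_right_of_not_simplicial hbip (hs2 i).symm (hs1 (next i)).symm (hs.ne (hne i)) (hss _ _)
  have hB : ∀ i, c i ∈ B := by
    intro i
    have hi : next ⟨(i.val + (k - 1)) % k, Nat.mod_lt _ (by omega)⟩ = i := by
      ext
      simp only [next, Nat.mod_add_mod]
      rw [show i.val + (k - 1) + 1 = i.val + k by omega, Nat.add_mod_right,
        Nat.mod_eq_of_lt i.isLt]
    exact hi ▸ hB_next _
  have key : ∀ i, ∃ x ∈ A, G.Adj x (c i) ∧ G.Adj x (c (next i)) ∧
      ∀ j, G.Adj x (c j) → (cliqueNeighborhoods G A).Adj (s i) (c j) := by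
    intro i
    by_cases hsA : s i ∈ A
    · refine ⟨s i, hsA, adj_of_cliqueNeighborhoods_adj hbip hsA (hs1 i),
        adj_of_cliqueNeighborhoods_adj hbip hsA (hs2 i), fun j h => ?_⟩
      exact (SimpleGraph.fromRel_adj _ _ _).2 ⟨(hcs j i).symm, Or.inl (Or.inl h)⟩
    · have hsB := hbip.mem_right_of_notMem_left hsA
      obtain ⟨x, hx, hxs, hxc⟩ :=
        exists_common_of_cliqueNeighborhoods_adj hbip hsB (hB i) (hs1 i)
      obtain ⟨y, hy, hyc, hyc'⟩ :=
        exists_common_of_cliqueNeighborhoods_adj hbip (hB i) (hB (next i)) (hcc _ _ (hne i))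
      obtain ⟨z, hz, hzs, hzc⟩ :=
        exists_common_of_cliqueNeighborhoods_adj hbip hsB (hB (next i)) (hs2 i)
      obtain ⟨a, ha, has, hac, hac'⟩ := hG.exists_common_neighbor_s11 hbip hsB (hB i) (hB (next i))
        (hcs _ _).symm (hc.ne (hne i)) (hcs _ _) hx hy hz hxs hxc hyc hyc' hzc hzs
      exact ⟨a, ha, hac, hac', fun j h =>
        cliqueNeighborhoods_adj_of_common ha has h (hcs j i).symm⟩
  choose t htA ht ht' hts using key
  refine hG.not_alternating_cycle hbip hk c t hc hB htA fun i j =>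
    ⟨fun h => (hsc i j).1 (hts i j h), ?_⟩
  rintro (h | h)
  · rw [Fin.ext h]
    exact ht i
  · rw [show j = next i from Fin.ext h]
    exact ht' i

end Bipartite

/-- If `G = (A, B, E)` is chordal bipartite then `G_B^*` is strongly chordal. -/
theorem cliqueNeighborhoods_stronglyChordal [Fintype V]
    (G : SimpleGraph V) (A B : Set V) (hbip : IsBipartition G A B)
    (hG : ChordalBipartite G) :
    StronglyChordal (cliqueNeighborhoods G A) := by
  exact ⟨hG.isChordalGraph_cliqueNeighborhoods hbip,
    fun _ hk => hG.not_hasInducedSun_cliqueNeighborhoods hbip hk⟩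
end

section
/- Let G = (A,B,E) be a chordal bipartite graph. Then the number of distinct nonempty sets of the form N(x) with x ∈ A is at most |B|(|B|+1)/2. -/
variable {V : Type*}

/-- Three distinct vertices of a bipartite graph such that each two of them have a common neighbor in
`A` that is not adjacent to the third one give rise to an induced 6-cycle. -/
lemma hasInducedCycle_six {G : SimpleGraph V} {A B : Set V} (hbip : IsBipartition G A B)
    {a b c x y z : V} (hab : a ≠ b) (hac : a ≠ c) (hbc : b ≠ c)
    (hx : x ∈ A) (hy : y ∈ A) (hz : z ∈ A)
    (hxa : G.Adj x a) (hxb : G.Adj x b) (hxc : ¬ G.Adj x c)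
    (hyb : G.Adj y b) (hyc : G.Adj y c) (hya : ¬ G.Adj y a)
    (hza : G.Adj z a) (hzc : G.Adj z c) (hzb : ¬ G.Adj z b) :
    hasInducedCycle G 6 := by
  obtain ⟨-, hdisj, hadj⟩ := hbip
  have hAB : ∀ {u v}, u ∈ A → G.Adj u v → v ∈ B := fun hu h ↦ by
    rcases hadj h with h' | h'
    · exact h'.2
    · exact absurd ⟨hu, h'.1⟩ (hdisj _)
  have hAA : ∀ {u v}, u ∈ A → v ∈ A → ¬ G.Adj u v := fun hu hv h ↦ hdisj _ ⟨hv, hAB hu h⟩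
  have hBB : ∀ {u v}, u ∈ B → v ∈ B → ¬ G.Adj u v := fun hu hv h ↦ by
    rcases hadj h with h' | h'
    · exact hdisj _ ⟨h'.1, hu⟩
    · exact hdisj _ ⟨h'.2, hv⟩
  have hne : ∀ {u v}, u ∈ A → v ∈ B → u ≠ v := fun hu hv h ↦ hdisj _ ⟨hu, h ▸ hv⟩
  have ha := hAB hx hxa
  have hb := hAB hx hxb
  have hc := hAB hy hyc
  have hxy : x ≠ y := fun h ↦ hya (h ▸ hxa)
  have hxz : x ≠ z := fun h ↦ hzb (h ▸ hxb)
  have hyz : y ≠ z := fun h ↦ hzb (h ▸ hyb)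
  refine ⟨![a, x, b, y, c, z], ?_, ?_⟩
  · intro i j h
    fin_cases i <;> fin_cases j <;>
      simp_all [hne hx ha, hne hx hb, hne hx hc, hne hy ha, hne hy hb, hne hy hc, hne hz ha,
        hne hz hb, hne hz hc, (hne hx ha).symm, (hne hx hb).symm, (hne hx hc).symm,
        (hne hy ha).symm, (hne hy hb).symm, (hne hy hc).symm, (hne hz ha).symm, (hne hz hb).symm,
        (hne hz hc).symm, hab.symm, hac.symm, hbc.symm, hxy.symm, hxz.symm, hyz.symm]
  · intro i j
    fin_cases i <;> fin_cases j <;>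
      simp [hxa, hxb, hxc, hya, hyb, hyc, hza, hzb, hzc, hxa.symm, hxb.symm, hyb.symm,
        hyc.symm, hza.symm, hzc.symm, mt G.adj_symm hxc, mt G.adj_symm hya, mt G.adj_symm hzb,
        hAA hx hy, hAA hx hz, hAA hy hz, hAA hy hx, hAA hz hx, hAA hz hy,
        hBB ha hb, hBB ha hc, hBB hb hc, hBB hb ha, hBB hc ha, hBB hc hb]

/-- A family of nonempty subsets of `B` that shatters no three-element set, even after adding the
empty set to it, has at most `|B| * (|B| + 1) / 2` members. -/
lemma Finset.card_le_of_forall_shatters_card_le_two [DecidableEq V] {𝒜 : Finset (Finset V)}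
    {B : Finset V} (hB : ∀ s ∈ 𝒜, s ⊆ B) (hempty : ∅ ∉ 𝒜)
    (h : ∀ t, (insert ∅ 𝒜).Shatters t → t.card ≤ 2) :
    𝒜.card ≤ B.card * (B.card + 1) / 2 := by
  have hsub : (insert ∅ 𝒜).shatterer ⊆
      (Finset.range 3).biUnion fun k ↦ Finset.powersetCard k B := by
    intro t ht
    rw [Finset.mem_shatterer] at ht
    obtain ⟨u, hu, htu⟩ := ht.exists_superset
    have huB : u ⊆ B := by
      rcases Finset.mem_insert.1 hu with rfl | hu
      · exact Finset.empty_subset _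
      · exact hB u hu
    simp only [Finset.mem_biUnion, Finset.mem_range, Finset.mem_powersetCard]
    exact ⟨t.card, Nat.lt_succ_of_le (h t ht), htu.trans huB, rfl⟩
  have hcard := (Finset.card_le_card_shatterer (insert ∅ 𝒜)).trans
    ((Finset.card_le_card hsub).trans Finset.card_biUnion_le)
  simp only [Finset.card_insert_of_notMem hempty, Finset.card_powersetCard,
    Finset.sum_range_succ, Finset.sum_range_zero, Nat.choose_zero_right,
    Nat.choose_one_right] at hcard
  have := Nat.triangle_succ B.card
  rw [Nat.add_sub_cancel, ← Nat.choose_two_right] at this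
  rw [mul_comm]
  omega

/-- In a chordal bipartite graph `G = (A, B, E)`, the number of distinct nonempty
neighborhoods of vertices of `A` is at most `|B| * (|B| + 1) / 2`. -/
theorem card_hyperedges_le [Fintype V]
    (G : SimpleGraph V) (A B : Set V) (hbip : IsBipartition G A B)
    (hG : ChordalBipartite G) :
    {s : Set V | s.Nonempty ∧ ∃ x ∈ A, G.neighborSet x = s}.ncard ≤
      B.ncard * (B.ncard + 1) / 2 := by
  classical
  set 𝒜 : Finset (Finset V) :=
    {s | s.Nonempty ∧ ∃ x ∈ A, G.neighborSet x = (s : Set V)} with h𝒜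
  have himage : {s : Set V | s.Nonempty ∧ ∃ x ∈ A, G.neighborSet x = s} =
      (fun s : Finset V ↦ (s : Set V)) '' (𝒜 : Set (Finset V)) := by
    ext s
    constructor
    · rintro ⟨hs, x, hx, rfl⟩
      refine ⟨(G.neighborSet x).toFinset, ?_, by simp⟩
      simp only [h𝒜, Finset.coe_filter, Set.mem_ofPred_eq, Set.coe_toFinset]
      exact ⟨Finset.mem_univ _, by simpa only [Set.toFinset_nonempty] using hs, x, hx, rfl⟩
    · rintro ⟨s, hs, rfl⟩
      simpa [h𝒜] using hs
  rw [himage, Set.ncard_image_of_injective _ Finset.coe_injective, Set.ncard_coe_finset,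
    Set.ncard_eq_toFinset_card' B]
  refine Finset.card_le_of_forall_shatters_card_le_two ?_ (by simp [h𝒜]) ?_
  · intro s hs v hv
    simp only [h𝒜, Finset.mem_filter, Finset.mem_univ, true_and] at hs
    obtain ⟨-, x, hx, hxs⟩ := hs
    have hxv : G.Adj x v := by
      rw [← SimpleGraph.mem_neighborSet, hxs]
      exact hv
    rcases hbip.2.2 hxv with h | h
    · simpa using h.2
    · exact absurd ⟨hx, h.1⟩ (hbip.2.1 x)
  · intro t ht
    by_contra! hcard
    obtain ⟨a, b, c, ha, hb, hc, hab, hac, hbc⟩ := Finset.two_lt_card_iff.1 hcard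
    have key : ∀ {p q r}, p ∈ t → q ∈ t → r ∈ t → r ≠ p → r ≠ q →
        ∃ x ∈ A, G.Adj x p ∧ G.Adj x q ∧ ¬ G.Adj x r := by
      intro p q r hp hq hr hrp hrq
      obtain ⟨u, hu, htu⟩ := ht (t := {p, q}) (by grind)
      have hmem : ∀ v ∈ t, v ∈ u ↔ v = p ∨ v = q := fun v hv ↦ by
        simpa [hv] using congrArg (v ∈ ·) htu
      have hpu : p ∈ u := (hmem p hp).2 (.inl rfl)
      have hqu : q ∈ u := (hmem q hq).2 (.inr rfl)
      have hru : r ∉ u := fun h ↦ ((hmem r hr).1 h).elim hrp hrq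
      have hu' : u ∈ 𝒜 := Finset.mem_of_mem_insert_of_ne hu (Finset.ne_empty_of_mem hpu)
      simp only [h𝒜, Finset.mem_filter, Finset.mem_univ, true_and] at hu'
      obtain ⟨-, x, hx, hxu⟩ := hu'
      have hadj : ∀ v, G.Adj x v ↔ v ∈ u := fun v ↦ by
        rw [← SimpleGraph.mem_neighborSet, hxu, Finset.mem_coe]
      exact ⟨x, hx, (hadj p).2 hpu, (hadj q).2 hqu, mt (hadj r).1 hru⟩
    obtain ⟨x, hx, hxa, hxb, hxc⟩ := key ha hb hc hac.symm hbc.symm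
    obtain ⟨y, hy, hyb, hyc, hya⟩ := key hb hc ha hab hac
    obtain ⟨z, hz, hza, hzc, hzb⟩ := key ha hc hb hab.symm hbc
    exact hG 6 (by norm_num) (hasInducedCycle_six hbip hab hac hbc hx hy hz hxa hxb hxc
      hyb hyc hya hza hzc hzb)
end

section
/- Let G = (A,B,E) be a chordal bipartite graph and let R be a hyperedge of G. Assume there exist hyperedges H_1 and H_2 of G such that |H_1 ∩ R| = |H_2 ∩ R| = 1 and H_1 ∩ R ≠ H_2 ∩ R. Then H_1 ∩ H_2 = ∅. -/
variable {V : Type*}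

/-- Let `R = N(x)` be a hyperedge of a chordal bipartite graph `G = (A, B, E)`. If
hyperedges `H₁ = N(x₁)` and `H₂ = N(x₂)` satisfy `|H₁ ∩ R| = |H₂ ∩ R| = 1` and
`H₁ ∩ R ≠ H₂ ∩ R`, then `H₁ ∩ H₂ = ∅`. -/
theorem hyperedges_disjoint [Fintype V]
    (G : SimpleGraph V) (A B : Set V) (hbip : IsBipartition G A B)
    (hG : ChordalBipartite G) (x x₁ x₂ : V) (hx : x ∈ A) (hx₁ : x₁ ∈ A) (hx₂ : x₂ ∈ A)
    (h1 : (G.neighborSet x₁ ∩ G.neighborSet x).ncard = 1)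
    (h2 : (G.neighborSet x₂ ∩ G.neighborSet x).ncard = 1)
    (hne : G.neighborSet x₁ ∩ G.neighborSet x ≠ G.neighborSet x₂ ∩ G.neighborSet x) :
    G.neighborSet x₁ ∩ G.neighborSet x₂ = ∅ := by
  obtain ⟨-, hdisj, hedge⟩ := hbip
  have hAA : ∀ {a b}, a ∈ A → b ∈ A → ¬ G.Adj a b := by grind
  have hBB : ∀ {a b}, a ∈ B → b ∈ B → ¬ G.Adj a b := by grind
  have hAB : ∀ {a b}, a ∈ A → G.Adj a b → b ∈ B := by grind
  obtain ⟨u, hu⟩ := Set.ncard_eq_one.mp h1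
  obtain ⟨v, hv⟩ := Set.ncard_eq_one.mp h2
  have huv : u ≠ v := by grind
  have hu' : ∀ y, (G.Adj x₁ y ∧ G.Adj x y) ↔ y = u := fun y => Set.ext_iff.mp hu y
  have hv' : ∀ y, (G.Adj x₂ y ∧ G.Adj x y) ↔ y = v := fun y => Set.ext_iff.mp hv y
  obtain ⟨h1u, hxu⟩ := (hu' u).mpr rfl
  obtain ⟨h2v, hxv⟩ := (hv' v).mpr rfl
  rw [Set.eq_empty_iff_forall_notMem]
  rintro w ⟨h1w : G.Adj x₁ w, h2w : G.Adj x₂ w⟩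
  have hxw : ¬ G.Adj x w := fun h => huv (((hu' w).mp ⟨h1w, h⟩).symm.trans ((hv' w).mp ⟨h2w, h⟩))
  have h1v : ¬ G.Adj x₁ v := fun h => huv ((hu' v).mp ⟨h, hxv⟩).symm
  have h2u : ¬ G.Adj x₂ u := fun h => huv ((hv' u).mp ⟨h, hxu⟩)
  have huB := hAB hx hxu
  have hvB := hAB hx hxv
  have hwB := hAB hx₁ h1w
  refine hG 6 (by norm_num) ⟨![x, u, x₁, w, x₂, v], ?_, ?_⟩
  · intro i j hij
    fin_cases i <;> fin_cases j <;> first | rfl | (exfalso; simp at hij; grind)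
  · intro i j
    fin_cases i <;> fin_cases j <;>
      simp [hAA, hBB, hx, hx₁, hx₂, huB, hvB, hwB, h1u, hxu, h2v, hxv, h1w, h2w, hxw, h1v, h2u,
        h1u.symm, hxu.symm, h2v.symm, hxv.symm, h1w.symm, h2w.symm, mt G.adj_symm hxw, mt G.adj_symm h1v,
        mt G.adj_symm h2u]
end

section
/- Let G = (A,B,E) be a bipartite graph and let x and y be two vertices in A with N(x) ⊆ N(y). Suppose F is a feedback vertex set of G with x ∈ F and y ∉ F. Then F' = (F − {x}) ∪ {y} is also a feedback vertex set of G. -/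
variable {V : Type*}

/-- `F` is a feedback vertex set of `G`: the induced subgraph `G - F` is a forest. -/
def IsFVS (G : SimpleGraph V) (F : Set V) : Prop :=
  (G.induce Fᶜ).IsAcyclic

/-- Let `x, y ∈ A` with `N(x) ⊆ N(y)`. If `F` is a feedback vertex set with `x ∈ F` and
`y ∉ F`, then `(F - x) + y` is also a feedback vertex set. -/
theorem fvs_exchange [Fintype V]
    (G : SimpleGraph V) (A B : Set V) (hbip : IsBipartition G A B)
    (x y : V) (hx : x ∈ A) (hy : y ∈ A) (hsub : G.neighborSet x ⊆ G.neighborSet y)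
    (F : Set V) (hF : IsFVS G F) (hxF : x ∈ F) (hyF : y ∉ F) :
    IsFVS G ((F \ {x}) ∪ {y}) := by
  classical
  have mem_compl {v : V} (hv : v ∈ ((F \ {x}) ∪ {y})ᶜ) : v ≠ y ∧ (v ≠ x → v ∉ F) := by
    simp only [Set.mem_compl_iff, Set.mem_union, Set.mem_sdiff, Set.mem_singleton_iff] at hv
    tauto
  let f : G.induce ((F \ {x}) ∪ {y})ᶜ →g G.induce Fᶜ :=
    { toFun := fun v => if h : v.1 = x then ⟨y, hyF⟩ else ⟨v.1, (mem_compl v.2).2 h⟩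
      map_rel' := by
        rintro ⟨u, hu⟩ ⟨w, hw⟩ (h : G.Adj u w)
        by_cases hux : u = x <;> by_cases hwx : w = x
        · subst hux hwx
          exact (G.irrefl h).elim
        · subst hux
          simpa [hwx] using hsub h
        · subst hwx
          simpa [hux] using (hsub h.symm).symm
        · simpa [hux, hwx] using h }
  refine SimpleGraph.IsAcyclic.comap f ?_ hF
  rintro ⟨u, hu⟩ ⟨w, hw⟩ (h : dite _ _ _ = dite _ _ _)
  have huy := (mem_compl hu).1
  have hwy := (mem_compl hw).1
  ext
  grind
end
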